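/- arXiv:2207.04374 — 2 statements merged into one kernel-verified Lean document; each statement's English description precedes it below -/
import Mathlib

section
/- Let q be an even positive integer and m ≥ 1. If f, g : {0,1}^m → Z_q form a q-ary Golay array pair of size 2^(m), then the pair is standard: there exist a permutation π of {1,…,m} and constants c_0, c', c_1, …, c_m ∈ Z_q such that, for all x ∈ {0,1}^m, f(x) = (q/2)·Σ_{k=1}^{m−1} x_{π(k)} x_{π(k+1)} + Σ_{k=1}^{m} c_k x_k + c_0 and g(x) = f(x) + (q/2)·x_{π(1)} + c' (the bits x_i being regarded as elements of Z_q). -/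
open scoped BigOperators

/-- ζ = exp(2πi/q). -/
noncomputable def zeta (q : ℕ) : ℂ := Complex.exp (2 * Real.pi * Complex.I / q)

/-- ζ^c for c ∈ Z_q (well defined since ζ^q = 1). -/
noncomputable def zetaPow (q : ℕ) (c : ZMod q) : ℂ := zeta q ^ c.val

/-- Aperiodic cross-correlation of arrays u, v at shift τ:
    C_{u,v}(τ) = Σ_{x, x+τ ∈ {0,1}^m} ζ^{u(x+τ) - v(x)}. -/
noncomputable def corr (q m : ℕ) (u v : (Fin m → Fin 2) → ZMod q) (τ : Fin m → ℤ) : ℂ :=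
  ∑ y : Fin m → Fin 2, ∑ x : Fin m → Fin 2,
    if ∀ i, ((y i : ℕ) : ℤ) - ((x i : ℕ) : ℤ) = τ i then zetaPow q (u y - v x) else 0

/-- (f, g) is a Golay array pair of size 2^(m). -/
def IsGAP (q m : ℕ) (f g : (Fin m → Fin 2) → ZMod q) : Prop :=
  ∀ τ : Fin m → ℤ, (∀ i, τ i = -1 ∨ τ i = 0 ∨ τ i = 1) → τ ≠ 0 →
    corr q m f f τ + corr q m g g τ = 0

/-- Generating function of an array, as a function on ℂ^m. -/
noncomputable def genFun (q m : ℕ) (f : (Fin m → Fin 2) → ZMod q) (z : Fin m → ℂ) : ℂ :=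
  ∑ x : Fin m → Fin 2, zetaPow q (f x) * ∏ i, (z i) ^ ((x i : ℕ))

/-- Coefficient-wise conjugate of the generating function, as a function on ℂ^m. -/
noncomputable def genFunConj (q m : ℕ) (f : (Fin m → Fin 2) → ZMod q) (z : Fin m → ℂ) : ℂ :=
  ∑ x : Fin m → Fin 2, (starRingEnd ℂ) (zetaPow q (f x)) * ∏ i, (z i) ^ ((x i : ℕ))

/-- Generating function of an array, as a multivariate polynomial. -/
noncomputable def genPoly (q m : ℕ) (f : (Fin m → Fin 2) → ZMod q) :
    MvPolynomial (Fin m) ℂ :=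
  ∑ x : Fin m → Fin 2, MvPolynomial.C (zetaPow q (f x)) * ∏ i, (MvPolynomial.X i) ^ ((x i : ℕ))

/-- Generating function of an array on a subset S of the coordinates. -/
noncomputable def genPolyOn (q m : ℕ) (S : Finset (Fin m)) (a : (↥S → Fin 2) → ZMod q) :
    MvPolynomial (Fin m) ℂ :=
  ∑ u : ↥S → Fin 2, MvPolynomial.C (zetaPow q (a u)) * ∏ k : ↥S, (MvPolynomial.X (k : Fin m)) ^ ((u k : ℕ))

/-- (f, g) is a standard Golay array pair of size 2^(m). -/
def IsStandard (q m : ℕ) (hm : 0 < m) (f g : (Fin m → Fin 2) → ZMod q) : Prop :=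
  ∃ π : Equiv.Perm (Fin m), ∃ c0 c' : ZMod q, ∃ c : Fin m → ZMod q,
    (∀ x : Fin m → Fin 2,
        f x = ((q / 2 : ℕ) : ZMod q) *
            (∑ k : Fin m, if h : (k : ℕ) + 1 < m then
                ((x (π k) : ℕ) : ZMod q) * ((x (π ⟨(k : ℕ) + 1, h⟩) : ℕ) : ZMod q) else 0)
          + (∑ k : Fin m, c k * ((x k : ℕ) : ZMod q)) + c0)
    ∧ (∀ x : Fin m → Fin 2,
        g x = f x + ((q / 2 : ℕ) : ZMod q) * ((x (π ⟨0, hm⟩) : ℕ) : ZMod q) + c')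

section SquarefreePolynomials

variable {ι : Type*}

/-- The polynomial `∑_{X ⊆ S} u(X) ∏_{k ∈ X} z_k`. -/
noncomputable def sqfreePoly (S : Finset ι) (u : Finset ι → ℂ) : MvPolynomial ι ℂ :=
  ∑ X ∈ S.powerset, MvPolynomial.C (u X) * ∏ k ∈ X, MvPolynomial.X k

theorem sqfreePoly_congr {S : Finset ι} {u v : Finset ι → ℂ} (h : ∀ X ⊆ S, u X = v X) :
    sqfreePoly S u = sqfreePoly S v :=
  Finset.sum_congr rfl fun X hX => by rw [h X (Finset.mem_powerset.1 hX)]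

theorem sqfreePoly_neg (S : Finset ι) (u : Finset ι → ℂ) :
    sqfreePoly S (fun X => -u X) = -sqfreePoly S u := by
  simp [sqfreePoly, Finset.sum_neg_distrib]

theorem aeval_sqfreePoly_of_eq_X {S : Finset ι} {θ : ι → MvPolynomial ι ℂ}
    (hθ : ∀ k ∈ S, θ k = MvPolynomial.X k) (u : Finset ι → ℂ) :
    MvPolynomial.aeval θ (sqfreePoly S u) = sqfreePoly S u := by
  simp only [sqfreePoly, map_sum, map_mul, map_prod, MvPolynomial.aeval_X,
    MvPolynomial.algHom_C, MvPolynomial.algebraMap_eq]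
  refine Finset.sum_congr rfl fun X hX => ?_
  rw [Finset.prod_congr rfl fun k hk => hθ k (Finset.mem_powerset.1 hX hk)]

theorem aeval_sqfreePoly_of_eq_one {S : Finset ι} {θ : ι → MvPolynomial ι ℂ}
    (hθ : ∀ k ∈ S, θ k = 1) (u : Finset ι → ℂ) :
    MvPolynomial.aeval θ (sqfreePoly S u) = MvPolynomial.C (∑ X ∈ S.powerset, u X) := by
  simp only [sqfreePoly, map_sum, map_mul, map_prod, MvPolynomial.aeval_X,
    MvPolynomial.algHom_C, MvPolynomial.algebraMap_eq]
  refine Finset.sum_congr rfl fun X hX => ?_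
  rw [Finset.prod_congr rfl fun k hk => hθ k (Finset.mem_powerset.1 hX hk)]
  simp

variable [DecidableEq ι]

theorem sqfreePoly_insert {S : Finset ι} {i : ι} (hi : i ∉ S) (u : Finset ι → ℂ) :
    sqfreePoly (insert i S) u =
      sqfreePoly S u + MvPolynomial.X i * sqfreePoly S (fun X => u (insert i X)) := by
  rw [sqfreePoly, Finset.sum_powerset_insert hi, sqfreePoly, sqfreePoly, Finset.mul_sum]
  congr 1
  refine Finset.sum_congr rfl fun X hX => ?_
  rw [Finset.prod_insert fun h => hi (Finset.mem_powerset.1 hX h)]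
  ring

theorem sqfreePoly_mul {S T : Finset ι} (hST : Disjoint S T) {u v w : Finset ι → ℂ}
    (h : ∀ X ⊆ S, ∀ Y ⊆ T, w (X ∪ Y) = u X * v Y) :
    sqfreePoly S u * sqfreePoly T v = sqfreePoly (S ∪ T) w := by
  induction S using Finset.induction_on generalizing u w with
  | empty =>
    rw [Finset.empty_union, sqfreePoly, Finset.powerset_empty, Finset.sum_singleton,
      Finset.prod_empty, mul_one, sqfreePoly, sqfreePoly, Finset.mul_sum]
    refine Finset.sum_congr rfl fun Y hY => ?_
    have := h ∅ (Finset.Subset.refl _) Y (Finset.mem_powerset.1 hY)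
    rw [Finset.empty_union] at this
    rw [this, MvPolynomial.C_mul, mul_assoc]
  | insert i S hi ih =>
    rw [Finset.disjoint_insert_left] at hST
    have hi' : i ∉ S ∪ T := by simp [hi, hST.1]
    rw [Finset.insert_union, sqfreePoly_insert hi, sqfreePoly_insert hi', add_mul, mul_assoc,
      ih hST.2 fun X hX Y hY => h X (hX.trans (Finset.subset_insert _ _)) Y hY,
      ih hST.2 (u := fun X => u (insert i X)) (w := fun X => w (insert i X)) fun X hX Y hY => by
        rw [← Finset.insert_union]
        exact h _ (Finset.insert_subset_insert _ hX) Y hY]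

theorem prod_X_eq_monomial (X : Finset ι) :
    ∏ k ∈ X, (MvPolynomial.X k : MvPolynomial ι ℂ) =
      MvPolynomial.monomial (Multiset.toFinsupp X.val) 1 := by
  induction X using Finset.induction_on with
  | empty => simp
  | insert i X hi ih =>
    rw [Finset.prod_insert hi, ih, MvPolynomial.X, MvPolynomial.monomial_mul,
      Finset.insert_val_of_notMem hi, ← Multiset.singleton_add, map_add,
      Multiset.toFinsupp_singleton, one_mul]

theorem coeff_sqfreePoly (S : Finset ι) (u : Finset ι → ℂ) (d : ι →₀ ℕ) :
    MvPolynomial.coeff d (sqfreePoly S u) =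
      ∑ X ∈ S.powerset, if Multiset.toFinsupp X.val = d then u X else 0 := by
  simp only [sqfreePoly, MvPolynomial.coeff_sum, prod_X_eq_monomial, MvPolynomial.coeff_C_mul,
    MvPolynomial.coeff_monomial, mul_ite, mul_one, mul_zero]

theorem coeff_sqfreePoly_toFinsupp {S X : Finset ι} (hX : X ⊆ S) (u : Finset ι → ℂ) :
    MvPolynomial.coeff (Multiset.toFinsupp X.val) (sqfreePoly S u) = u X := by
  rw [coeff_sqfreePoly, Finset.sum_eq_single_of_mem X (Finset.mem_powerset.2 hX)]
  · simp
  · intro Y _ hYX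
    rw [if_neg]
    intro h
    exact hYX (Finset.val_injective (Multiset.toFinsupp.injective h))

theorem toFinsupp_val_apply (X : Finset ι) (k : ι) :
    Multiset.toFinsupp X.val k = if k ∈ X then 1 else 0 := by
  rw [Multiset.toFinsupp_apply, Multiset.count_eq_of_nodup X.nodup]
  rfl

theorem degreeOf_sqfreePoly {S : Finset ι} {u : Finset ι → ℂ} (hu : ∀ X ⊆ S, u X ≠ 0) (k : ι) :
    MvPolynomial.degreeOf k (sqfreePoly S u) = if k ∈ S then 1 else 0 := by
  apply le_antisymm
  · rw [MvPolynomial.degreeOf_le_iff]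
    intro d hd
    rw [MvPolynomial.mem_support_iff, coeff_sqfreePoly] at hd
    obtain ⟨X, hX, hne⟩ := Finset.exists_ne_zero_of_sum_ne_zero hd
    obtain rfl : Multiset.toFinsupp X.val = d := by
      by_contra h
      exact hne (if_neg h)
    rw [toFinsupp_val_apply]
    have := @Finset.mem_powerset.1 hX k
    split_ifs <;> simp_all
  · split_ifs with hk
    · have hk' : {k} ⊆ S := Finset.singleton_subset_iff.2 hk
      refine le_trans ?_ (MvPolynomial.monomial_le_degreeOf k
        (m := Multiset.toFinsupp ({k} : Finset ι).val) ?_)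
      · rw [toFinsupp_val_apply]; simp
      · rw [MvPolynomial.mem_support_iff, coeff_sqfreePoly_toFinsupp hk']
        exact hu _ hk'
    · exact Nat.zero_le _

theorem sqfreePoly_ne_zero {S : Finset ι} {u : Finset ι → ℂ} (hu : ∀ X ⊆ S, u X ≠ 0) :
    sqfreePoly S u ≠ 0 := fun h =>
  hu ∅ (Finset.empty_subset _) <| by
    rw [← coeff_sqfreePoly_toFinsupp (Finset.empty_subset S) u, h, MvPolynomial.coeff_zero]

theorem exists_eq_sqfreePoly {S : Finset ι} {P : MvPolynomial ι ℂ}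
    (hP : ∀ k, MvPolynomial.degreeOf k P ≤ if k ∈ S then 1 else 0) :
    ∃ u, P = sqfreePoly S u := by
  refine ⟨fun X => MvPolynomial.coeff (Multiset.toFinsupp X.val) P, ?_⟩
  ext d
  by_cases hd : ∃ X ⊆ S, Multiset.toFinsupp X.val = d
  · obtain ⟨X, hX, rfl⟩ := hd
    rw [coeff_sqfreePoly_toFinsupp hX]
  · rw [coeff_sqfreePoly, Finset.sum_eq_zero fun X hX => if_neg fun h =>
      hd ⟨X, Finset.mem_powerset.1 hX, h⟩]
    by_contra hne
    have hle k : d k ≤ if k ∈ S then 1 else 0 :=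
      (MvPolynomial.monomial_le_degreeOf k (MvPolynomial.mem_support_iff.2 hne)).trans (hP k)
    refine hd ⟨d.support, fun k hk => ?_, ?_⟩
    · by_contra hkS
      have := hle k
      simp_all
    · ext k
      rw [toFinsupp_val_apply]
      have := hle k
      by_cases hk : d k = 0
      · simp [hk]
      · rw [if_pos (Finsupp.mem_support_iff.2 hk)]
        split_ifs at this <;> omega

/-- Proportional squarefree pairs `F₀ F₁' + G₀ G₁' = 0` with nowhere vanishing coefficients
split along a common partition of the variables. -/
theorem exists_split_of_mul_add_mul_eq_zero {S : Finset ι} {f₀ f₁ g₀ g₁ : Finset ι → ℂ}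
    (hf₀ : ∀ X ⊆ S, f₀ X ≠ 0) (hf₁ : ∀ X ⊆ S, f₁ X ≠ 0)
    (hg₀ : ∀ X ⊆ S, g₀ X ≠ 0)
    (h : sqfreePoly S f₀ * sqfreePoly S f₁ + sqfreePoly S g₀ * sqfreePoly S g₁ = 0) :
    ∃ S₁ S₂, Disjoint S₁ S₂ ∧ S₁ ∪ S₂ = S ∧ ∃ p r a b : Finset ι → ℂ,
      ∀ X ⊆ S₁, ∀ Y ⊆ S₂, f₀ (X ∪ Y) = p X * a Y ∧ g₀ (X ∪ Y) = p X * b Y ∧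
        f₁ (X ∪ Y) = r X * b Y ∧ g₁ (X ∪ Y) = -(r X * a Y) := by
  have hF₀ := sqfreePoly_ne_zero hf₀
  have hF₁ := sqfreePoly_ne_zero hf₁
  have hG₀ := sqfreePoly_ne_zero hg₀
  obtain ⟨A, B, P, hrel, hPA, hPB⟩ :=
    UniqueFactorizationMonoid.exists_reduced_factors _ hF₀ (sqfreePoly S g₀)
  have hP : P ≠ 0 := left_ne_zero_of_mul (hPA ▸ hF₀)
  have hA : A ≠ 0 := right_ne_zero_of_mul (hPA ▸ hF₀)
  have hB : B ≠ 0 := right_ne_zero_of_mul (hPB ▸ hG₀)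
  have key : A * sqfreePoly S f₁ = B * -sqfreePoly S g₁ := by
    apply mul_left_cancel₀ hP
    linear_combination h + sqfreePoly S f₁ * hPA + sqfreePoly S g₁ * hPB
  obtain ⟨R, hR⟩ : B ∣ sqfreePoly S f₁ := hrel.symm.dvd_of_dvd_mul_left ⟨_, key⟩
  have hR₀ : R ≠ 0 := right_ne_zero_of_mul (hR ▸ hF₁)
  have hG₁ : sqfreePoly S g₁ = -(R * A) := by
    apply mul_left_cancel₀ hB
    linear_combination key - A * hR
  have dA k : P.degreeOf k + A.degreeOf k = if k ∈ S then 1 else 0 := by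
    rw [← MvPolynomial.degreeOf_mul_eq hP hA, hPA, degreeOf_sqfreePoly hf₀]
  have dB k : P.degreeOf k + B.degreeOf k = if k ∈ S then 1 else 0 := by
    rw [← MvPolynomial.degreeOf_mul_eq hP hB, hPB, degreeOf_sqfreePoly hg₀]
  have dR k : B.degreeOf k + R.degreeOf k = if k ∈ S then 1 else 0 := by
    rw [← MvPolynomial.degreeOf_mul_eq hB hR₀, ← hR, degreeOf_sqfreePoly hf₁]
  obtain ⟨S₁, S₂, hS₁, hS₂, hdisj, hunion⟩ : ∃ S₁ S₂ : Finset ι,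
      (∀ k, k ∈ S₁ ↔ k ∈ S ∧ P.degreeOf k = 1) ∧ (∀ k, k ∈ S₂ ↔ k ∈ S ∧ ¬ P.degreeOf k = 1) ∧
      Disjoint S₁ S₂ ∧ S₁ ∪ S₂ = S :=
    ⟨S.filter fun k => P.degreeOf k = 1, S.filter fun k => ¬ P.degreeOf k = 1,
      fun _ => Finset.mem_filter, fun _ => Finset.mem_filter,
      Finset.disjoint_filter_filter_not _ _ _, Finset.filter_union_filter_not_eq _ _⟩
  obtain ⟨p, rfl⟩ : ∃ p, P = sqfreePoly S₁ p := exists_eq_sqfreePoly fun k => by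
    have := dA k
    grind
  obtain ⟨r, rfl⟩ : ∃ r, R = sqfreePoly S₁ r := exists_eq_sqfreePoly fun k => by
    have := dB k
    have := dR k
    grind
  obtain ⟨a, rfl⟩ : ∃ a, A = sqfreePoly S₂ a := exists_eq_sqfreePoly fun k => by
    have := dA k
    grind
  obtain ⟨b, rfl⟩ : ∃ b, B = sqfreePoly S₂ b := exists_eq_sqfreePoly fun k => by
    have := dB k
    grind
  have read {u v w : Finset ι → ℂ} (huv : sqfreePoly S w = sqfreePoly S₁ u * sqfreePoly S₂ v) :
      ∀ X ⊆ S₁, ∀ Y ⊆ S₂, w (X ∪ Y) = u X * v Y := by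
    intro X hX Y hY
    have hXY : X ∪ Y ⊆ S := hunion ▸ Finset.union_subset_union hX hY
    rw [sqfreePoly_mul hdisj (w := fun Z => u (Z ∩ S₁) * v (Z ∩ S₂)), hunion] at huv
    · have e₁ : (X ∪ Y) ∩ S₁ = X := by
        rw [Finset.union_inter_distrib_right, Finset.inter_eq_left.2 hX,
          Finset.disjoint_iff_inter_eq_empty.1 (hdisj.symm.mono_left hY), Finset.union_empty]
      have e₂ : (X ∪ Y) ∩ S₂ = Y := by
        rw [Finset.union_inter_distrib_right, Finset.inter_eq_left.2 hY,
          Finset.disjoint_iff_inter_eq_empty.1 (hdisj.mono_left hX), Finset.empty_union]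
      rw [← coeff_sqfreePoly_toFinsupp hXY w, huv, coeff_sqfreePoly_toFinsupp hXY, e₁, e₂]
    · intro X hX Y hY
      rw [Finset.union_inter_distrib_right, Finset.union_inter_distrib_right,
        Finset.inter_eq_left.2 hX, Finset.inter_eq_left.2 hY,
        Finset.disjoint_iff_inter_eq_empty.1 (hdisj.symm.mono_left hY),
        Finset.disjoint_iff_inter_eq_empty.1 (hdisj.mono_left hX), Finset.union_empty,
        Finset.empty_union]
  refine ⟨S₁, S₂, hdisj, hunion, p, r, a, b, fun X hX Y hY =>
    ⟨read hPA.symm X hX Y hY, read hPB.symm X hX Y hY,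
      read (hR.trans (mul_comm _ _)) X hX Y hY, ?_⟩⟩
  have := read (w := fun Z => -g₁ Z) (by rw [sqfreePoly_neg, hG₁, neg_neg]) X hX Y hY
  rw [← this, neg_neg]

end SquarefreePolynomials

section PathForms

variable {A : Type*} [CommRing A]

/-- The sum of the products of consecutive entries of a list. -/
def pathForm : List A → A
  | [] => 0
  | [_] => 0
  | a :: b :: t => a * b + pathForm (b :: t)

theorem pathForm_append_cons (u : List A) (a : A) (v : List A) :
    pathForm (u ++ a :: v) =
      pathForm u + u.getLastD 0 * a + (a * v.headD 0 + pathForm v) := by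
  induction u with
  | nil => cases v <;> simp [pathForm]
  | cons b t ih =>
    cases t with
    | nil => cases v <;> simp [pathForm]
    | cons c t =>
      simp only [List.cons_append, pathForm, List.getLastD_cons] at ih ⊢
      rw [ih]
      ring

theorem mul_pathForm_add_pathForm_compl {h : A} (hh : h + h = 0) (u : List A) :
    h * (pathForm u + pathForm (u.map (1 - ·))) =
      h * (u.headD 0 + u.getLastD 0) + h * (u.length - 1 : ℕ) := by
  induction u with
  | nil => simp [pathForm]
  | cons a t ih =>
    cases t with
    | nil => simp [pathForm, mul_add, ← add_mul, hh]
    | cons b t =>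
      simp only [pathForm, List.map_cons, List.headD_cons, List.getLastD_cons,
        List.length_cons, Nat.add_sub_cancel] at ih ⊢
      push_cast
      linear_combination ih + (a * b - a) * hh

theorem mul_headD_compl {h : A} (hh : h + h = 0) (u : List A) :
    h * (u.map (1 - ·)).headD 0 = h * u.headD 0 + if u.length = 0 then 0 else h := by
  cases u with
  | nil => simp
  | cons a t =>
    simp only [List.map_cons, List.headD_cons, List.length_cons, Nat.succ_ne_zero, if_false]
    linear_combination -a * hh

theorem headD_append_zero (u v : List A) : (u ++ 0 :: v).headD 0 = u.headD 0 := by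
  cases u <;> rfl

theorem mul_headD_append_one {h : A} (hh : h + h = 0) (u v : List A) :
    h * (u ++ 1 :: v).headD 0 = h * (u.map (1 - ·)).headD 0 + h := by
  cases u with
  | nil => simp
  | cons a t =>
    simp only [List.cons_append, List.headD_cons, List.map_cons]
    linear_combination (a - 1) * hh

theorem pathForm_map_eq_sum {ι : Type*} (x : ι → A) (l : List ι) (n : ℕ) (hn : l.length = n) :
    pathForm (l.map x) = ∑ k : Fin n, if h : (k : ℕ) + 1 < n then
      x l[(k : ℕ)] * x l[(k : ℕ) + 1] else 0 := by
  subst hn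
  induction l with
  | nil => simp [pathForm]
  | cons a t ih =>
    cases t with
    | nil => simp [pathForm]
    | cons b t =>
      rw [List.map_cons, List.map_cons, pathForm, ← List.map_cons, ih]
      simp only [List.length_cons]
      rw [Fin.sum_univ_succ (n := t.length + 1)]
      simp

end PathForms

section GolayPairs

variable {ι A : Type*} [DecidableEq ι] [CommRing A]

/-- The generating polynomial of an `A`-valued array on the subsets of `S`. -/
noncomputable def arrayPoly (χ : AddChar A ℂ) (S : Finset ι) (f : Finset ι → A) :
    MvPolynomial ι ℂ :=
  sqfreePoly S fun X => χ (f X)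

/-- The conjugate reciprocal of the generating polynomial of an array. -/
noncomputable def arrayPolyRev (χ : AddChar A ℂ) (S : Finset ι) (f : Finset ι → A) :
    MvPolynomial ι ℂ :=
  sqfreePoly S fun X => χ (-f (S \ X))

/-- The Golay condition for a pair of arrays, expressed through generating polynomials. -/
def IsGolayOn (χ : AddChar A ℂ) (S : Finset ι) (f g : Finset ι → A) : Prop :=
  ∃ c : ℂ, c ≠ 0 ∧ arrayPoly χ S f * arrayPolyRev χ S f + arrayPoly χ S g * arrayPolyRev χ S g =
    MvPolynomial.C c * ∏ k ∈ S, MvPolynomial.X k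

/-- The standard form of a pair of arrays, with the path given as a list of coordinates. -/
def IsStandardOn (h : A) (S : Finset ι) (f g : Finset ι → A) : Prop :=
  ∃ l : List ι, l.Nodup ∧ l.toFinset = S ∧ ∃ (c₀ c' : A) (c : ι → A), ∀ X ⊆ S,
    f X = h * pathForm (l.map fun k => if k ∈ X then 1 else 0) + ∑ k ∈ X, c k + c₀ ∧
    g X = f X + h * (l.map fun k => if k ∈ X then 1 else 0).headD 0 + c'

variable {χ : AddChar A ℂ} {S S₁ S₂ : Finset ι} {i : ι} {f g : Finset ι → A}

theorem arrayPoly_insert (hi : i ∉ S) :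
    arrayPoly χ (insert i S) f =
      arrayPoly χ S f + MvPolynomial.X i * arrayPoly χ S (fun X => f (insert i X)) :=
  sqfreePoly_insert hi _

theorem arrayPolyRev_insert (hi : i ∉ S) :
    arrayPolyRev χ (insert i S) f =
      arrayPolyRev χ S (fun X => f (insert i X)) + MvPolynomial.X i * arrayPolyRev χ S f := by
  have h₀ : sqfreePoly S (fun X => χ (-f (insert i S \ X))) =
      arrayPolyRev χ S fun X => f (insert i X) := sqfreePoly_congr fun X hX => by
    rw [Finset.insert_sdiff_of_notMem _ fun h => hi (hX h)]
  have h₁ : sqfreePoly S (fun X => χ (-f (insert i S \ insert i X))) = arrayPolyRev χ S f :=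
    sqfreePoly_congr fun X hX => by
      rw [Finset.insert_sdiff_insert, Finset.sdiff_insert_of_notMem hi]
  rw [arrayPolyRev, sqfreePoly_insert hi, h₀, h₁]

theorem union_sdiff_union (hdisj : Disjoint S₁ S₂) {X Y : Finset ι} (hX : X ⊆ S₁) (hY : Y ⊆ S₂) :
    (S₁ ∪ S₂) \ (X ∪ Y) = S₁ \ X ∪ S₂ \ Y := by
  ext k
  have hk : k ∈ S₁ → k ∉ S₂ := fun h => Finset.disjoint_left.1 hdisj h
  have hkX := @hX k
  have hkY := @hY k
  simp only [Finset.mem_sdiff, Finset.mem_union]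
  tauto

theorem exists_eq_C_mul_prod_of_mul_eq (hdisj : Disjoint S₁ S₂) {U V : MvPolynomial ι ℂ} {c v : ℂ}
    (hc : c ≠ 0)
    (hUV : U * V = MvPolynomial.C c * ((∏ k ∈ S₁, MvPolynomial.X k) * ∏ k ∈ S₂, MvPolynomial.X k))
    (hU : ∀ θ : ι → MvPolynomial ι ℂ, (∀ k ∈ S₁, θ k = MvPolynomial.X k) →
      MvPolynomial.aeval θ U = U)
    (hV : ∀ θ : ι → MvPolynomial ι ℂ, (∀ k ∈ S₂, θ k = 1) →
      MvPolynomial.aeval θ V = MvPolynomial.C v) :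
    ∃ c : ℂ, c ≠ 0 ∧ U = MvPolynomial.C c * ∏ k ∈ S₁, MvPolynomial.X k := by
  let θ : ι → MvPolynomial ι ℂ := fun k => if k ∈ S₁ then MvPolynomial.X k else 1
  have h₁ : ∀ k ∈ S₁, θ k = MvPolynomial.X k := fun k hk => if_pos hk
  have h₂ : ∀ k ∈ S₂, θ k = 1 := fun k hk => if_neg (Finset.disjoint_right.1 hdisj hk)
  have key := congrArg (MvPolynomial.aeval θ) hUV
  simp only [map_mul, map_prod, hU θ h₁, hV θ h₂, MvPolynomial.aeval_X, MvPolynomial.algHom_C,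
    MvPolynomial.algebraMap_eq, Finset.prod_congr rfl h₁, Finset.prod_congr rfl h₂,
    Finset.prod_const_one, mul_one] at key
  have hv : v ≠ 0 := by
    rintro rfl
    rw [MvPolynomial.C_0, mul_zero, eq_comm, mul_eq_zero, MvPolynomial.C_eq_zero,
      Finset.prod_eq_zero_iff] at key
    obtain h | ⟨k, -, hk⟩ := key
    · exact hc h
    · exact MvPolynomial.X_ne_zero k hk
  refine ⟨c / v, div_ne_zero hc hv, ?_⟩
  apply mul_right_cancel₀ ((MvPolynomial.C_eq_zero (σ := ι)).not.2 hv)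
  rw [key, mul_right_comm, ← MvPolynomial.C_mul, div_mul_cancel₀ c hv]

theorem isGolayOn_of_mul_eq (hdisj : Disjoint S₁ S₂) {p r a b : Finset ι → A} {c : ℂ} (hc : c ≠ 0)
    (h : (arrayPoly χ S₁ p * arrayPolyRev χ S₁ p + arrayPoly χ S₁ r * arrayPolyRev χ S₁ r) *
        (arrayPoly χ S₂ a * arrayPolyRev χ S₂ a + arrayPoly χ S₂ b * arrayPolyRev χ S₂ b) =
      MvPolynomial.C c * ((∏ k ∈ S₁, MvPolynomial.X k) * ∏ k ∈ S₂, MvPolynomial.X k)) :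
    IsGolayOn χ S₁ p r := by
  refine exists_eq_C_mul_prod_of_mul_eq hdisj
    (v := (∑ X ∈ S₂.powerset, χ (a X)) * (∑ X ∈ S₂.powerset, χ (-a (S₂ \ X))) +
      (∑ X ∈ S₂.powerset, χ (b X)) * ∑ X ∈ S₂.powerset, χ (-b (S₂ \ X)))
    hc h (fun θ hθ => ?_) (fun θ hθ => ?_)
  · simp only [map_add, map_mul, arrayPoly, arrayPolyRev, aeval_sqfreePoly_of_eq_X hθ]
  · simp only [map_add, map_mul, arrayPoly, arrayPolyRev, aeval_sqfreePoly_of_eq_one hθ]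

/-- A Golay pair on `S ∪ {i}` arises from Golay pairs on the two parts of a partition of `S`. -/
theorem IsGolayOn.exists_split (hχ : Function.Injective χ) {h : A} (hh : χ h = -1) (hi : i ∉ S)
    (hfg : IsGolayOn χ (insert i S) f g) :
    ∃ S₁ S₂, Disjoint S₁ S₂ ∧ S₁ ∪ S₂ = S ∧ ∃ p r a b : Finset ι → A,
      IsGolayOn χ S₁ p r ∧ IsGolayOn χ S₂ a b ∧
      ∀ X ⊆ S₁, ∀ Y ⊆ S₂, f (X ∪ Y) = p X + a Y ∧ g (X ∪ Y) = p X + b Y ∧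
        f (insert i (X ∪ Y)) = r X - b (S₂ \ Y) ∧
        g (insert i (X ∪ Y)) = r X - a (S₂ \ Y) + h := by
  obtain ⟨c, hc, hpoly⟩ := hfg
  rw [arrayPoly_insert hi, arrayPoly_insert hi, arrayPolyRev_insert hi, arrayPolyRev_insert hi,
    Finset.prod_insert hi] at hpoly
  have hzero := congrArg (MvPolynomial.aeval fun k =>
    if k = i then (0 : MvPolynomial ι ℂ) else MvPolynomial.X k) hpoly
  have hθ : ∀ k ∈ S, (if k = i then (0 : MvPolynomial ι ℂ) else MvPolynomial.X k) =
      MvPolynomial.X k := fun k hk => if_neg (ne_of_mem_of_not_mem hk hi)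
  simp only [map_add, map_mul, arrayPoly, arrayPolyRev, aeval_sqfreePoly_of_eq_X hθ,
    MvPolynomial.aeval_X, if_true, zero_mul, mul_zero, add_zero] at hzero
  have hne (a : A) : χ a ≠ 0 := fun ha => by
    simpa [ha] using AddChar.map_add_eq_mul χ a (-a)
  obtain ⟨S₁, S₂, hdisj, rfl, p, r, a, b, hsplit⟩ :=
    exists_split_of_mul_add_mul_eq_zero (fun _ _ => hne _) (fun _ _ => hne _)
      (fun _ _ => hne _) hzero
  have hhh : h + h = 0 := hχ (by rw [AddChar.map_add_eq_mul, hh, AddChar.map_zero_eq_one]; norm_num)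
  have hs₁ X (hX : X ⊆ S₁) := hsplit X hX ∅ (Finset.empty_subset _)
  have hs₂ := hsplit ∅ (Finset.empty_subset _)
  have hcompl {X Y} (hX : X ⊆ S₁) (hY : Y ⊆ S₂) :
      χ (-f (insert i (X ∪ Y))) = r (S₁ \ X) * b (S₂ \ Y) ∧
      χ (-g (insert i (X ∪ Y))) = -(r (S₁ \ X) * a (S₂ \ Y)) := by
    have := hsplit (S₁ \ X) Finset.sdiff_subset (S₂ \ Y) Finset.sdiff_subset
    rw [union_sdiff_union hdisj Finset.sdiff_subset Finset.sdiff_subset,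
      Finset.sdiff_sdiff_eq_self hX, Finset.sdiff_sdiff_eq_self hY] at this
    exact this.2.2
  simp only [Finset.union_empty, Finset.empty_union] at hs₁ hs₂
  have h₁ {X Y} (hX : X ⊆ S₁) (hY : Y ⊆ S₂) : f (X ∪ Y) + f ∅ = f X + f Y := hχ <| by
    simp only [AddChar.map_add_eq_mul]
    rw [(hsplit X hX Y hY).1, (hs₁ X hX).1, (hs₂ Y hY).1, (hs₂ ∅ (Finset.empty_subset _)).1]
    ring
  have h₂ {X Y} (hX : X ⊆ S₁) (hY : Y ⊆ S₂) : g (X ∪ Y) + f ∅ = f X + g Y := hχ <| by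
    simp only [AddChar.map_add_eq_mul]
    rw [(hsplit X hX Y hY).2.1, (hs₁ X hX).1, (hs₂ Y hY).2.1, (hs₂ ∅ (Finset.empty_subset _)).1]
    ring
  have h₃ {X Y} (hX : X ⊆ S₁) (hY : Y ⊆ S₂) :
      -f (insert i (X ∪ Y)) + g S₂ = -f (insert i X) + g (S₂ \ Y) := hχ <| by
    have e := hcompl hX (Finset.empty_subset S₂)
    rw [Finset.union_empty, Finset.sdiff_empty] at e
    simp only [AddChar.map_add_eq_mul]
    rw [(hcompl hX hY).1, e.1, (hs₂ S₂ subset_rfl).2.1, (hs₂ _ Finset.sdiff_subset).2.1]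
    ring
  have h₄ {X Y} (hX : X ⊆ S₁) (hY : Y ⊆ S₂) :
      -g (insert i (X ∪ Y)) + g S₂ = h + (-f (insert i X) + f (S₂ \ Y)) := hχ <| by
    have e := hcompl hX (Finset.empty_subset S₂)
    rw [Finset.union_empty, Finset.sdiff_empty] at e
    simp only [AddChar.map_add_eq_mul]
    rw [(hcompl hX hY).2, e.1, (hs₂ S₂ subset_rfl).2.1, (hs₂ _ Finset.sdiff_subset).1, hh]
    ring
  clear hzero hsplit hs₁ hs₂ hcompl p r a b
  obtain ⟨p, r, a, b, hrel⟩ : ∃ p r a b : Finset ι → A,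
      ∀ X ⊆ S₁, ∀ Y ⊆ S₂, f (X ∪ Y) = p X + a Y ∧ g (X ∪ Y) = p X + b Y ∧
        f (insert i (X ∪ Y)) = r X - b (S₂ \ Y) ∧
        g (insert i (X ∪ Y)) = r X - a (S₂ \ Y) + h := by
    refine ⟨f, fun X => f (insert i X) + (g S₂ - f ∅), fun Y => f Y - f ∅, fun Y => g Y - f ∅,
      fun X hX Y hY => ⟨?_, ?_, ?_, ?_⟩⟩
    · linear_combination h₁ hX hY
    · linear_combination h₂ hX hY
    · linear_combination -h₃ hX hY
    · linear_combination -h₄ hX hY - hhh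
  have hneg (u : A) : χ (u + h) = -χ u := by rw [AddChar.map_add_eq_mul, hh, mul_neg_one]
  have hneg' (u : A) : χ (u - h) = -χ u := by
    rw [← hneg, show u - h = u + h by linear_combination -hhh]
  have eF₀ : arrayPoly χ (S₁ ∪ S₂) f = arrayPoly χ S₁ p * arrayPoly χ S₂ a :=
    (sqfreePoly_mul hdisj fun X hX Y hY => by
      rw [(hrel X hX Y hY).1, AddChar.map_add_eq_mul]).symm
  have eG₀ : arrayPoly χ (S₁ ∪ S₂) g = arrayPoly χ S₁ p * arrayPoly χ S₂ b :=
    (sqfreePoly_mul hdisj fun X hX Y hY => by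
      rw [(hrel X hX Y hY).2.1, AddChar.map_add_eq_mul]).symm
  have eF₁ : arrayPoly χ (S₁ ∪ S₂) (fun X => f (insert i X)) =
      arrayPoly χ S₁ r * arrayPolyRev χ S₂ b :=
    (sqfreePoly_mul hdisj fun X hX Y hY => by
      beta_reduce
      rw [(hrel X hX Y hY).2.2.1, sub_eq_add_neg, AddChar.map_add_eq_mul]).symm
  have eG₁ : arrayPoly χ (S₁ ∪ S₂) (fun X => g (insert i X)) =
      -(arrayPoly χ S₁ r * arrayPolyRev χ S₂ a) := by
    rw [eq_neg_iff_add_eq_zero, add_comm, ← eq_neg_iff_add_eq_zero, arrayPoly, arrayPoly,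
      arrayPolyRev, ← sqfreePoly_neg]
    refine sqfreePoly_mul hdisj fun X hX Y hY => ?_
    rw [(hrel X hX Y hY).2.2.2, hneg, neg_neg, sub_eq_add_neg, AddChar.map_add_eq_mul]
  have hrel' X (hX : X ⊆ S₁) Y (hY : Y ⊆ S₂) :=
    hrel (S₁ \ X) Finset.sdiff_subset (S₂ \ Y) Finset.sdiff_subset
  have eF₀' : arrayPolyRev χ (S₁ ∪ S₂) f = arrayPolyRev χ S₁ p * arrayPolyRev χ S₂ a :=
    (sqfreePoly_mul hdisj fun X hX Y hY => by
      rw [union_sdiff_union hdisj hX hY, (hrel' X hX Y hY).1, neg_add,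
        AddChar.map_add_eq_mul]).symm
  have eG₀' : arrayPolyRev χ (S₁ ∪ S₂) g = arrayPolyRev χ S₁ p * arrayPolyRev χ S₂ b :=
    (sqfreePoly_mul hdisj fun X hX Y hY => by
      rw [union_sdiff_union hdisj hX hY, (hrel' X hX Y hY).2.1, neg_add,
        AddChar.map_add_eq_mul]).symm
  have eF₁' : arrayPolyRev χ (S₁ ∪ S₂) (fun X => f (insert i X)) =
      arrayPolyRev χ S₁ r * arrayPoly χ S₂ b :=
    (sqfreePoly_mul hdisj fun X hX Y hY => by
      beta_reduce
      rw [union_sdiff_union hdisj hX hY, (hrel' X hX Y hY).2.2.1, Finset.sdiff_sdiff_eq_self hY,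
        neg_sub, sub_eq_neg_add, AddChar.map_add_eq_mul]).symm
  have eG₁' : arrayPolyRev χ (S₁ ∪ S₂) (fun X => g (insert i X)) =
      -(arrayPolyRev χ S₁ r * arrayPoly χ S₂ a) := by
    rw [eq_neg_iff_add_eq_zero, add_comm, ← eq_neg_iff_add_eq_zero, arrayPoly, arrayPolyRev,
      arrayPolyRev, ← sqfreePoly_neg]
    refine sqfreePoly_mul hdisj fun X hX Y hY => ?_
    rw [union_sdiff_union hdisj hX hY, (hrel' X hX Y hY).2.2.2, Finset.sdiff_sdiff_eq_self hY,
      neg_add, ← sub_eq_add_neg, hneg', neg_neg, neg_sub, sub_eq_neg_add, AddChar.map_add_eq_mul]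
  rw [eF₀, eG₀, eF₁, eG₁, eF₀', eG₀', eF₁', eG₁', Finset.prod_union hdisj] at hpoly
  have hprod : (arrayPoly χ S₁ p * arrayPolyRev χ S₁ p + arrayPoly χ S₁ r * arrayPolyRev χ S₁ r) *
        (arrayPoly χ S₂ a * arrayPolyRev χ S₂ a + arrayPoly χ S₂ b * arrayPolyRev χ S₂ b) =
      MvPolynomial.C c * ((∏ k ∈ S₁, MvPolynomial.X k) * ∏ k ∈ S₂, MvPolynomial.X k) := by
    apply mul_left_cancel₀ (MvPolynomial.X_ne_zero (R := ℂ) i)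
    linear_combination hpoly
  refine ⟨S₁, S₂, hdisj, rfl, p, r, a, b, isGolayOn_of_mul_eq hdisj hc hprod,
    isGolayOn_of_mul_eq hdisj.symm (p := a) (r := b) (a := p) (b := r) hc ?_, hrel⟩
  linear_combination hprod

/-- Golay pairs are standard. -/
theorem IsGolayOn.isStandardOn (hχ : Function.Injective χ) {h : A} (hh : χ h = -1)
    (hfg : IsGolayOn χ S f g) : IsStandardOn h S f g := by
  have hhh : h + h = 0 := hχ (by rw [AddChar.map_add_eq_mul, hh, AddChar.map_zero_eq_one]; norm_num)
  induction S using Finset.strongInduction generalizing f g with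
  | H S ih =>
  obtain rfl | ⟨i, hiS⟩ := S.eq_empty_or_nonempty
  · refine ⟨[], List.nodup_nil, rfl, f ∅, g ∅ - f ∅, 0, fun X hX => ?_⟩
    rw [Finset.subset_empty.1 hX]
    simp [pathForm]
  obtain ⟨S, hi, rfl⟩ : ∃ T, i ∉ T ∧ insert i T = S :=
    ⟨S.erase i, Finset.notMem_erase _ _, Finset.insert_erase hiS⟩
  obtain ⟨S₁, S₂, hdisj, rfl, p, r, a, b, hpr, hab, hrel⟩ := hfg.exists_split hχ hh hi
  obtain ⟨l₁, hl₁, hS₁, c₀, c', c, hst₁⟩ := ih S₁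
    ((Finset.subset_union_left).trans_ssubset (Finset.ssubset_insert hi)) hpr
  obtain ⟨l₂, hl₂, hS₂, d₀, d', d, hst₂⟩ := ih S₂
    ((Finset.subset_union_right).trans_ssubset (Finset.ssubset_insert hi)) hab
  have m₁ k : k ∈ l₁ ↔ k ∈ S₁ := by rw [← hS₁, List.mem_toFinset]
  have m₂ k : k ∈ l₂ ↔ k ∈ S₂ := by rw [← hS₂, List.mem_toFinset]
  have hd k (hk : k ∈ S₁) : k ∉ S₂ := Finset.disjoint_left.1 hdisj hk
  have hi₁ : i ∉ S₁ := fun e => hi (Finset.mem_union_left _ e)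
  have hi₂ : i ∉ S₂ := fun e => hi (Finset.mem_union_right _ e)
  obtain ⟨e₁, he₁⟩ : ∃ e, e = h * (l₂.length - 1 : ℕ) := ⟨_, rfl⟩
  obtain ⟨e₂, he₂⟩ : ∃ e, e = if l₂.length = 0 then 0 else h := ⟨_, rfl⟩
  refine ⟨l₂ ++ i :: l₁, ?_, ?_, c₀ + d₀, d', fun k => if k ∈ S₁ then c k else if k ∈ S₂ then d k
    else c' - e₁ - e₂ - ∑ k ∈ S₂, d k - 2 * d₀ - d', fun Z hZ => ?_⟩
  · rw [List.nodup_append, List.nodup_cons]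
    refine ⟨hl₂, ⟨fun e => hi₁ ((m₁ i).1 e), hl₁⟩, fun k hk j hj e => ?_⟩
    subst e
    rw [m₂] at hk
    rw [List.mem_cons, m₁] at hj
    obtain rfl | hj := hj
    exacts [hi₂ hk, hd k hj hk]
  · ext k
    simp only [List.mem_toFinset, List.mem_append, List.mem_cons, m₁, m₂, Finset.mem_insert,
      Finset.mem_union]
    tauto
  obtain ⟨X, hX, Y, hY, hZ⟩ : ∃ X ⊆ S₁, ∃ Y ⊆ S₂, Z = X ∪ Y ∨ Z = insert i (X ∪ Y) := by
    refine ⟨Z ∩ S₁, Finset.inter_subset_right, Z ∩ S₂, Finset.inter_subset_right, ?_⟩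
    by_cases hiZ : i ∈ Z
    · right
      ext k
      have := @hZ k
      grind
    · left
      ext k
      have := @hZ k
      grind
  have mem₁ k (hk : k ∈ S₁) : k ∈ Z ↔ k ∈ X := by
    have hkY := mt (@hY k) (hd k hk)
    have hki := ne_of_mem_of_not_mem hk hi₁
    obtain rfl | rfl := hZ <;> simp [hkY, hki]
  have mem₂ k (hk : k ∈ S₂) : k ∈ Z ↔ k ∈ Y := by
    have hkX := mt (@hX k) fun e => hd k e hk
    have hki := ne_of_mem_of_not_mem hk hi₂
    obtain rfl | rfl := hZ <;> simp [hkX, hki]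
  have map₁ : l₁.map (fun k => if k ∈ Z then (1 : A) else 0) =
      l₁.map (fun k => if k ∈ X then (1 : A) else 0) := List.map_congr_left fun k hk => by
    simp only [mem₁ k ((m₁ k).1 hk)]
  have map₂ : l₂.map (fun k => if k ∈ Z then (1 : A) else 0) =
      l₂.map (fun k => if k ∈ Y then (1 : A) else 0) := List.map_congr_left fun k hk => by
    simp only [mem₂ k ((m₂ k).1 hk)]
  have sum₁ : ∑ k ∈ X, (if k ∈ S₁ then c k else if k ∈ S₂ then d k
      else c' - e₁ - e₂ - ∑ k ∈ S₂, d k - 2 * d₀ - d') = ∑ k ∈ X, c k :=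
    Finset.sum_congr rfl fun k hk => if_pos (hX hk)
  have sum₂ : ∑ k ∈ Y, (if k ∈ S₁ then c k else if k ∈ S₂ then d k
      else c' - e₁ - e₂ - ∑ k ∈ S₂, d k - 2 * d₀ - d') = ∑ k ∈ Y, d k :=
    Finset.sum_congr rfl fun k hk => by
      rw [if_neg fun e => hd k e (hY hk), if_pos (hY hk)]
  have hXY : Disjoint X Y := hdisj.mono hX hY
  have hiXY : i ∉ X ∪ Y := fun e => hi (Finset.union_subset_union hX hY e)
  obtain ⟨hf, hg, hf', hg'⟩ := hrel X hX Y hY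
  obtain ⟨hp, hr⟩ := hst₁ X hX
  obtain ⟨ha, hb⟩ := hst₂ Y hY
  rw [List.map_append, List.map_cons, pathForm_append_cons, map₁, map₂]
  obtain rfl | rfl := hZ
  · rw [Finset.sum_union hXY, sum₁, sum₂, if_neg hiXY]
    constructor
    · linear_combination hf + hp + ha
    · rw [headD_append_zero]
      linear_combination hg - hf + hb
  · rw [Finset.sum_insert hiXY, Finset.sum_union hXY, sum₁, sum₂, if_neg hi₁, if_neg hi₂,
      if_pos (Finset.mem_insert_self _ _)]
    obtain ⟨ha', hb'⟩ := hst₂ (S₂ \ Y) Finset.sdiff_subset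
    have map₃ : l₂.map (fun k => if k ∈ S₂ \ Y then (1 : A) else 0) =
        (l₂.map (fun k => if k ∈ Y then (1 : A) else 0)).map (1 - ·) := by
      rw [List.map_map]
      refine List.map_congr_left fun k hk => ?_
      by_cases hkY : k ∈ Y <;> simp [(m₂ k).1 hk, hkY]
    have hQ := mul_pathForm_add_pathForm_compl hhh (l₂.map fun k => if k ∈ Y then (1 : A) else 0)
    have hH := mul_headD_compl hhh (l₂.map fun k => if k ∈ Y then (1 : A) else 0)
    rw [← map₃, List.length_map, ← he₁] at hQ
    rw [← map₃, List.length_map, ← he₂] at hH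
    have hsum := Finset.sum_sdiff (f := d) hY
    have hfZ : f (insert i (X ∪ Y)) = h * (pathForm (l₂.map fun k => if k ∈ Y then (1 : A) else 0) +
        (l₂.map fun k => if k ∈ Y then (1 : A) else 0).getLastD 0 * 1 +
        (1 * (l₁.map fun k => if k ∈ X then (1 : A) else 0).headD 0 +
          pathForm (l₁.map fun k => if k ∈ X then (1 : A) else 0))) +
        (c' - e₁ - e₂ - ∑ k ∈ S₂, d k - 2 * d₀ - d' + (∑ k ∈ X, c k + ∑ k ∈ Y, d k)) +
        (c₀ + d₀) := by
      linear_combination hf' + hr + hp - hb' - ha' - hQ - hH - hsum -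
        ((l₂.map fun k => if k ∈ Y then (1 : A) else 0).headD 0 +
          (l₂.map fun k => if k ∈ Y then (1 : A) else 0).getLastD 0) * hhh
    refine ⟨hfZ, ?_⟩
    rw [mul_headD_append_one hhh, ← map₃]
    linear_combination hg' - hf' + hb'

end GolayPairs

section ZModArrays

/-- Points of the discrete cube as sets of coordinates. -/
def cubeEquiv (m : ℕ) : Finset (Fin m) ≃ (Fin m → Fin 2) where
  toFun X k := if k ∈ X then 1 else 0
  invFun x := Finset.univ.filter fun k => x k = 1
  left_inv X := by ext k; simp
  right_inv x := by
    ext k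
    by_cases h : x k = 1
    · simp [h]
    · have : x k = 0 := by omega
      simp [this]

theorem cubeEquiv_apply_val {m : ℕ} (X : Finset (Fin m)) (k : Fin m) :
    (cubeEquiv m X k : ℕ) = if k ∈ X then 1 else 0 := by
  change ((if k ∈ X then 1 else 0 : Fin 2) : ℕ) = _
  split_ifs <;> rfl

theorem zeta_isPrimitiveRoot {q : ℕ} (hq : 0 < q) : IsPrimitiveRoot (zeta q) q :=
  Complex.isPrimitiveRoot_exp q hq.ne'

/-- The additive character `c ↦ ζ ^ c`. -/
noncomputable def zetaChar (q : ℕ) [NeZero q] : AddChar (ZMod q) ℂ :=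
  AddChar.zmodChar q (zeta_isPrimitiveRoot (NeZero.pos q)).pow_eq_one

theorem corr_eq_zero_of_notMem {q m : ℕ} (u v : (Fin m → Fin 2) → ZMod q) {τ : Fin m → ℤ}
    {k : Fin m} (hk : ¬(τ k = -1 ∨ τ k = 0 ∨ τ k = 1)) : corr q m u v τ = 0 :=
  Finset.sum_eq_zero fun y _ => Finset.sum_eq_zero fun x _ => if_neg fun h => hk <| by
    have := h k
    omega

theorem corr_self_zero {q m : ℕ} (f : (Fin m → Fin 2) → ZMod q) : corr q m f f 0 = 2 ^ m := by
  have h (y x : Fin m → Fin 2) :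
      (∀ i, ((y i : ℕ) : ℤ) - ((x i : ℕ) : ℤ) = (0 : Fin m → ℤ) i) ↔ y = x := by
    rw [funext_iff]
    refine forall_congr' fun k => ?_
    rw [Pi.zero_apply, sub_eq_zero, Nat.cast_inj, Fin.val_inj]
  simp only [corr, h]
  simp [zetaPow]

variable {q m : ℕ} [NeZero q]

theorem zetaChar_apply (c : ZMod q) : zetaChar q c = zetaPow q c :=
  AddChar.zmodChar_apply _ c

theorem zetaChar_injective : Function.Injective (zetaChar q) := fun a b h => by
  rw [zetaChar_apply, zetaChar_apply] at h
  exact ZMod.val_injective q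
    ((zeta_isPrimitiveRoot (NeZero.pos q)).pow_inj (ZMod.val_lt a) (ZMod.val_lt b) h)

theorem zetaChar_half (hqe : Even q) : zetaChar q ((q / 2 : ℕ) : ZMod q) = -1 := by
  have hq := NeZero.pos q
  rw [zetaChar_apply, zetaPow, ZMod.val_cast_of_lt (Nat.div_lt_self hq one_lt_two)]
  exact ((zeta_isPrimitiveRoot hq).pow hq
    (Nat.div_mul_cancel hqe.two_dvd).symm).eq_neg_one_of_two_right

theorem coeff_arrayPoly_mul_arrayPolyRev (f : (Fin m → Fin 2) → ZMod q) (d : Fin m →₀ ℕ) :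
    MvPolynomial.coeff d
        (arrayPoly (zetaChar q) Finset.univ (fun X => f (cubeEquiv m X)) *
          arrayPolyRev (zetaChar q) Finset.univ (fun X => f (cubeEquiv m X))) =
      corr q m f f fun k => (d k : ℤ) - 1 := by
  rw [corr, ← (cubeEquiv m).sum_comp, arrayPoly, arrayPolyRev, sqfreePoly, sqfreePoly,
    Finset.sum_mul_sum, MvPolynomial.coeff_sum, Finset.powerset_univ]
  refine Finset.sum_congr rfl fun X _ => ?_
  rw [MvPolynomial.coeff_sum, ← (cubeEquiv m).sum_comp,
    ← Equiv.sum_comp (compl_involutive (α := Finset (Fin m))).toPerm]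
  refine Finset.sum_congr rfl fun Y _ => ?_
  rw [Function.Involutive.coe_toPerm, ← Finset.compl_eq_univ_sdiff, compl_compl,
    prod_X_eq_monomial, prod_X_eq_monomial, MvPolynomial.C_mul_monomial,
    MvPolynomial.C_mul_monomial, MvPolynomial.monomial_mul, MvPolynomial.coeff_monomial,
    mul_one, mul_one, ← AddChar.map_add_eq_mul, ← sub_eq_add_neg, zetaChar_apply]
  refine if_congr ?_ rfl rfl
  rw [DFunLike.ext_iff]
  refine forall_congr' fun k => ?_
  rw [Finsupp.add_apply, toFinsupp_val_apply, toFinsupp_val_apply, cubeEquiv_apply_val,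
    cubeEquiv_apply_val]
  simp only [Finset.mem_compl]
  split_ifs <;> push_cast <;> omega

theorem IsGAP.isGolayOn {f g : (Fin m → Fin 2) → ZMod q} (hfg : IsGAP q m f g) :
    IsGolayOn (zetaChar q) Finset.univ (fun X => f (cubeEquiv m X))
      (fun X => g (cubeEquiv m X)) := by
  refine ⟨2 ^ m + 2 ^ m, ?_, ?_⟩
  · rw [← two_mul]
    exact mul_ne_zero two_ne_zero (pow_ne_zero m two_ne_zero)
  ext d
  rw [MvPolynomial.coeff_add, coeff_arrayPoly_mul_arrayPolyRev, coeff_arrayPoly_mul_arrayPolyRev,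
    prod_X_eq_monomial, MvPolynomial.C_mul_monomial, MvPolynomial.coeff_monomial, mul_one]
  have hd : Multiset.toFinsupp (Finset.univ : Finset (Fin m)).val = d ↔
      (fun k => (d k : ℤ) - 1) = 0 := by
    rw [DFunLike.ext_iff, funext_iff]
    refine forall_congr' fun k => ?_
    rw [toFinsupp_val_apply, if_pos (Finset.mem_univ k), Pi.zero_apply]
    omega
  split_ifs with h
  · rw [hd.1 h, corr_self_zero, corr_self_zero]
  · by_cases hτ : ∀ k, (d k : ℤ) - 1 = -1 ∨ (d k : ℤ) - 1 = 0 ∨ (d k : ℤ) - 1 = 1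
    · exact hfg _ hτ (mt hd.2 h)
    · obtain ⟨k, hk⟩ := not_forall.1 hτ
      rw [corr_eq_zero_of_notMem f f hk, corr_eq_zero_of_notMem g g hk, add_zero]

end ZModArrays

/-- every q-ary Golay array pair of size 2^(m) (q even) is standard. -/
theorem gap_is_standard (q m : ℕ) (hq : 0 < q) (hqe : Even q) (hm : 0 < m)
    (f g : (Fin m → Fin 2) → ZMod q) (hGAP : IsGAP q m f g) :
    IsStandard q m hm f g := by
  have : NeZero q := ⟨hq.ne'⟩
  obtain ⟨l, hl, hmem, c₀, c', c, hst⟩ :=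
    hGAP.isGolayOn.isStandardOn zetaChar_injective (zetaChar_half hqe)
  have hmem' k : k ∈ l := by rw [← List.mem_toFinset, hmem]; exact Finset.mem_univ k
  have hlen : l.length = m := by
    rw [← List.toFinset_card_of_nodup hl, hmem, Finset.card_univ, Fintype.card_fin]
  let π : Equiv.Perm (Fin m) :=
    (finCongr hlen.symm).trans (hl.getEquivOfForallMemList l hmem')
  have hπ (k : Fin m) : π k = l[(k : ℕ)] := rfl
  have key (x : Fin m → Fin 2) :
      (f x = ((q / 2 : ℕ) : ZMod q) *
            (∑ k : Fin m, if h : (k : ℕ) + 1 < m then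
                ((x (π k) : ℕ) : ZMod q) * ((x (π ⟨(k : ℕ) + 1, h⟩) : ℕ) : ZMod q) else 0)
          + (∑ k : Fin m, c k * ((x k : ℕ) : ZMod q)) + c₀) ∧
        g x = f x + ((q / 2 : ℕ) : ZMod q) * ((x (π ⟨0, hm⟩) : ℕ) : ZMod q) + c' := by
    obtain ⟨X, rfl⟩ := (cubeEquiv m).surjective x
    obtain ⟨hf, hg⟩ := hst X (Finset.subset_univ X)
    beta_reduce at hf hg
    have hX (k : Fin m) : ((cubeEquiv m X k : ℕ) : ZMod q) = if k ∈ X then 1 else 0 := by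
      rw [cubeEquiv_apply_val, Nat.cast_ite, Nat.cast_one, Nat.cast_zero]
    simp only [hX, hπ]
    constructor
    · rw [hf, pathForm_map_eq_sum _ l m hlen]
      simp
    · rw [hg, List.headD_eq_head?_getD, List.head?_map, List.head?_eq_getElem?,
        List.getElem?_eq_getElem (hlen.symm ▸ hm)]
      rfl
  exact ⟨π, c₀, c', c, fun x => (key x).1, fun x => (key x).2⟩
end

section
/- Let q be an even positive integer and m ≥ 1. Suppose that for every n with 1 ≤ n ≤ m, every q-ary Golay array pair of size 2^(n) is standard. Then every q-ary Golay array pair of size 2^(m+1) is standard. -/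
open scoped BigOperators

namespace GolayArray

section Zeta

variable {q : ℕ} [NeZero q]

lemma isPrimitiveRoot_zeta : IsPrimitiveRoot (zeta q) q :=
  Complex.isPrimitiveRoot_exp q (NeZero.ne q)

omit [NeZero q] in
lemma zetaPow_zero : zetaPow q 0 = 1 := by simp [zetaPow]

lemma zetaPow_add (a b : ZMod q) : zetaPow q (a + b) = zetaPow q a * zetaPow q b := by
  rw [zetaPow, zetaPow, zetaPow, ZMod.val_add, ← pow_add]
  exact (pow_eq_pow_mod _ isPrimitiveRoot_zeta.pow_eq_one).symm

lemma zetaPow_ne_zero (a : ZMod q) : zetaPow q a ≠ 0 :=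
  pow_ne_zero _ (isPrimitiveRoot_zeta.ne_zero (NeZero.ne q))

lemma zetaPow_sub (a b : ZMod q) : zetaPow q (a - b) = zetaPow q a / zetaPow q b := by
  rw [eq_div_iff (zetaPow_ne_zero b), ← zetaPow_add, sub_add_cancel]

lemma zetaPow_injective : Function.Injective (zetaPow q) := fun a b h =>
  ZMod.val_injective q (isPrimitiveRoot_zeta.pow_inj a.val_lt b.val_lt h)

lemma half_add_half (hq : Even q) : ((q / 2 : ℕ) : ZMod q) + ((q / 2 : ℕ) : ZMod q) = 0 := by
  obtain ⟨k, rfl⟩ := hq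
  have : (k + k) / 2 = k := by omega
  rw [this, ← Nat.cast_add, ZMod.natCast_self]

lemma zetaPow_half (hq : Even q) : zetaPow q ((q / 2 : ℕ) : ZMod q) = -1 := by
  have hpos : 0 < q := NeZero.pos q
  have hq2 : 2 ≤ q := by
    obtain ⟨k, rfl⟩ := hq
    omega
  have hsq : zetaPow q ((q / 2 : ℕ) : ZMod q) * zetaPow q ((q / 2 : ℕ) : ZMod q) = 1 := by
    rw [← zetaPow_add, half_add_half hq, zetaPow_zero]
  refine (mul_self_eq_one_iff.1 hsq).resolve_left fun h => ?_
  rw [← zetaPow_zero (q := q)] at h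
  have := (ZMod.natCast_eq_zero_iff _ _).1 (zetaPow_injective h)
  have := Nat.le_of_dvd (by omega) this
  omega

end Zeta

section Factorization

open MvPolynomial

variable {ι : Type*} [Fintype ι]

/-- The exponent vector of a point of the cube. -/
noncomputable def exponent (x : ι → Fin 2) : ι →₀ ℕ :=
  Finsupp.equivFunOnFinite.symm fun i => (x i : ℕ)

@[simp]
lemma exponent_apply (x : ι → Fin 2) (i : ι) : exponent x i = (x i : ℕ) := rfl

lemma exponent_injective : Function.Injective (exponent : (ι → Fin 2) → ι →₀ ℕ) := fun x y h => by
  funext i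
  exact Fin.ext (DFunLike.congr_fun h i)

omit [Fintype ι] in
lemma coeff_mul_of_degreeOf_eq_zero {U : ι → Prop} [DecidablePred U] {P Q : MvPolynomial ι ℂ}
    (hP : ∀ i, ¬ U i → degreeOf i P = 0) (hQ : ∀ i, U i → degreeOf i Q = 0) (μ : ι →₀ ℕ) :
    coeff μ (P * Q) = coeff (μ.filter U) P * coeff (μ.filter (¬ U ·)) Q := by
  classical
  rw [coeff_mul]
  refine Finset.sum_eq_single (μ.filter U, μ.filter (¬ U ·)) ?_ fun h => ?_
  · rintro ⟨α, β⟩ hαβ hne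
    rw [Finset.HasAntidiagonal.mem_antidiagonal] at hαβ
    by_contra h
    obtain ⟨hα, hβ⟩ := mul_ne_zero_iff.1 h
    have hα' : ∀ i, α i ≤ degreeOf i P := fun i => monomial_le_degreeOf i (mem_support_iff.2 hα)
    have hβ' : ∀ i, β i ≤ degreeOf i Q := fun i => monomial_le_degreeOf i (mem_support_iff.2 hβ)
    refine hne (Prod.ext (Finsupp.ext fun i => ?_) (Finsupp.ext fun i => ?_)) <;>
      have hi := DFunLike.congr_fun hαβ i <;>
      simp only [Finsupp.filter_apply, Finsupp.add_apply] at hi ⊢ <;>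
      by_cases hU : U i <;> simp only [hU, not_true_eq_false, not_false_eq_true, if_true, if_false]
    · have := hβ' i; rw [hQ i hU] at this; omega
    · have := hα' i; rw [hP i hU] at this; omega
    · have := hβ' i; rw [hQ i hU] at this; omega
    · have := hα' i; rw [hP i hU] at this; omega
  · exact absurd (Finset.HasAntidiagonal.mem_antidiagonal.2 (Finsupp.filter_add_filter_not μ U)) h

/-- The exponent vector of a point of a subcube, extended by zero. -/
noncomputable def subExponent (U : ι → Prop) [DecidablePred U] (u : {i // U i} → Fin 2) : ι →₀ ℕ :=
  Finsupp.equivFunOnFinite.symm fun i => if h : U i then (u ⟨i, h⟩ : ℕ) else 0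

lemma filter_exponent (U : ι → Prop) [DecidablePred U] (x : ι → Fin 2) :
    (exponent x).filter U = subExponent U fun i => x i := by
  ext i
  by_cases h : U i <;> simp [subExponent, h]

variable [DecidableEq ι]

/-- The generating polynomial of a complex array on the cube. -/
noncomputable def cubePoly (u : (ι → Fin 2) → ℂ) : MvPolynomial ι ℂ :=
  ∑ x, monomial (exponent x) (u x)

lemma coeff_cubePoly_exponent (u : (ι → Fin 2) → ℂ) (x : ι → Fin 2) :
    coeff (exponent x) (cubePoly u) = u x := by
  simp [cubePoly, coeff_sum, coeff_monomial, exponent_injective.eq_iff]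

lemma degreeOf_cubePoly {u : (ι → Fin 2) → ℂ} (hu : ∀ x, u x ≠ 0) (i : ι) :
    degreeOf i (cubePoly u) = 1 := by
  apply le_antisymm
  · rw [degreeOf_le_iff]
    intro μ hμ
    obtain ⟨x, -, hx⟩ := Finset.exists_ne_zero_of_sum_ne_zero
      (by simpa [cubePoly, coeff_sum] using mem_support_iff.1 hμ)
    obtain rfl : exponent x = μ := by
      by_contra h
      exact hx (by simp [h])
    have := (x i).isLt
    rw [exponent_apply]
    omega
  · have h : exponent (fun _ : ι => (1 : Fin 2)) ∈ (cubePoly u).support := by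
      rw [mem_support_iff, coeff_cubePoly_exponent]
      exact hu _
    simpa using monomial_le_degreeOf i h

lemma cubePoly_ne_zero {u : (ι → Fin 2) → ℂ} (hu : ∀ x, u x ≠ 0) : cubePoly u ≠ 0 := fun h =>
  hu 0 (by rw [← coeff_cubePoly_exponent u, h, coeff_zero])

/-- Two factorizations of multilinear polynomials with full support split the variables. -/
lemma exists_split_of_cubePoly_mul_eq {b a d c : (ι → Fin 2) → ℂ}
    (hb : ∀ x, b x ≠ 0) (ha : ∀ x, a x ≠ 0) (hd : ∀ x, d x ≠ 0) (hc : ∀ x, c x ≠ 0)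
    (h : cubePoly b * cubePoly a = cubePoly d * cubePoly c) :
    ∃ (U : ι → Prop) (P S : ({i // U i} → Fin 2) → ℂ) (Q R : ({i // ¬ U i} → Fin 2) → ℂ),
      ∀ x : ι → Fin 2, b x = P (fun i => x i) * Q (fun i => x i) ∧
        d x = P (fun i => x i) * R (fun i => x i) ∧
        c x = S (fun i => x i) * Q (fun i => x i) ∧
        a x = S (fun i => x i) * R (fun i => x i) := by
  classical
  obtain ⟨P, Q, ⟨R, hR⟩, ⟨S, hS⟩, hPQ⟩ :=
    exists_dvd_and_dvd_of_dvd_mul (Dvd.intro _ h : cubePoly b ∣ cubePoly d * cubePoly c)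
  rw [mul_comm] at hS
  have hSR : cubePoly a = S * R := by
    refine mul_left_cancel₀ (cubePoly_ne_zero hb) ?_
    rw [h, hPQ, hR, hS]
    ring
  have deg : ∀ {u : (ι → Fin 2) → ℂ}, (∀ x, u x ≠ 0) → ∀ {A B : MvPolynomial ι ℂ},
      cubePoly u = A * B → ∀ i, degreeOf i A + degreeOf i B = 1 := by
    intro u hu A B hAB i
    have hne := cubePoly_ne_zero hu
    rw [hAB] at hne
    rw [← degreeOf_mul_eq (left_ne_zero_of_mul hne) (right_ne_zero_of_mul hne), ← hAB,
      degreeOf_cubePoly hu]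
  have coeff_eq : ∀ {u : (ι → Fin 2) → ℂ} {A B : MvPolynomial ι ℂ}, cubePoly u = A * B →
      (∀ i, ¬ degreeOf i P = 1 → degreeOf i A = 0) → (∀ i, degreeOf i P = 1 → degreeOf i B = 0) →
      ∀ x, u x = coeff (subExponent (degreeOf · P = 1) fun i => x i) A *
        coeff (subExponent (¬ degreeOf · P = 1) fun i => x i) B := by
    intro u A B hAB hA hB x
    rw [← coeff_cubePoly_exponent u, hAB, coeff_mul_of_degreeOf_eq_zero hA hB, filter_exponent,
      filter_exponent]
  refine ⟨(degreeOf · P = 1), fun u => coeff (subExponent _ u) P, fun u => coeff (subExponent _ u) S,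
    fun v => coeff (subExponent _ v) Q, fun v => coeff (subExponent _ v) R, fun x =>
    ⟨coeff_eq hPQ ?_ ?_ x, coeff_eq hR ?_ ?_ x, coeff_eq hS ?_ ?_ x, coeff_eq hSR ?_ ?_ x⟩⟩ <;>
  · intro i hi
    have h₁ := deg hb hPQ i
    have h₂ := deg hd hR i
    have h₃ := deg hc hS i
    have h₄ := deg ha hSR i
    omega

end Factorization

section Correlation

variable {ι κ : Type*} [Fintype ι] [DecidableEq ι] [Fintype κ] [DecidableEq κ] {q : ℕ}

/-- The reflection of the cube through its centre. -/
def cubeRev : (ι → Fin 2) ≃ (ι → Fin 2) where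
  toFun x i := (x i).rev
  invFun x i := (x i).rev
  left_inv x := by simp
  right_inv x := by simp

omit [Fintype ι] [DecidableEq ι] in
@[simp]
lemma cubeRev_apply (x : ι → Fin 2) (i : ι) : cubeRev x i = (x i).rev := rfl

omit [Fintype ι] [DecidableEq ι] in
@[simp]
lemma cubeRev_cubeRev (x : ι → Fin 2) : cubeRev (cubeRev x) = x := cubeRev.left_inv x

/-- The reversed conjugate of an array. -/
def conjRev (u : (ι → Fin 2) → ZMod q) (x : ι → Fin 2) : ZMod q := -u (cubeRev x)

lemma val_rev_fin_two (a : Fin 2) : ((a.rev : ℕ) : ℤ) = 1 - (a : ℕ) := by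
  rw [Fin.val_rev]
  omega

/-- The aperiodic cross-correlation of arrays indexed by a cube of arbitrary finite dimension. -/
noncomputable def crossCorr (u v : (ι → Fin 2) → ZMod q) (τ : ι → ℤ) : ℂ :=
  ∑ y : ι → Fin 2, ∑ x : ι → Fin 2,
    if ∀ i, ((y i : ℕ) : ℤ) - ((x i : ℕ) : ℤ) = τ i then zetaPow q (u y - v x) else 0

lemma corr_eq_crossCorr {m : ℕ} (u v : (Fin m → Fin 2) → ZMod q) (τ : Fin m → ℤ) :
    corr q m u v τ = crossCorr u v τ := by
  rw [corr, crossCorr]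
  congr!

lemma crossCorr_reindex (e : κ ≃ ι) (u v : (ι → Fin 2) → ZMod q) (τ : κ → ℤ) :
    crossCorr (fun x : κ → Fin 2 => u (x ∘ e.symm)) (fun x => v (x ∘ e.symm)) τ =
      crossCorr u v (τ ∘ e.symm) := by
  refine Fintype.sum_equiv (e.arrowCongr (Equiv.refl _)) _ _ fun y =>
    Fintype.sum_equiv (e.arrowCongr (Equiv.refl _)) _ _ fun x => ?_
  refine if_congr ?_ rfl rfl
  rw [← e.symm.forall_congr_right]
  rfl

lemma crossCorr_conjRev (u v : (ι → Fin 2) → ZMod q) (τ : ι → ℤ) :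
    crossCorr (conjRev u) (conjRev v) τ = crossCorr v u τ := by
  rw [crossCorr, Finset.sum_comm, crossCorr]
  refine Fintype.sum_equiv cubeRev _ _ fun x => Fintype.sum_equiv cubeRev _ _ fun y => ?_
  refine if_congr (forall_congr' fun i => ?_) (congrArg _ ?_) rfl
  · rw [cubeRev_apply, cubeRev_apply, val_rev_fin_two, val_rev_fin_two, sub_sub_sub_cancel_left]
  · rw [conjRev, conjRev]
    ring

lemma crossCorr_add_const (u v : (ι → Fin 2) → ZMod q) (k : ZMod q) (τ : ι → ℤ) :
    crossCorr (fun x => u x + k) (fun x => v x + k) τ = crossCorr u v τ := by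
  simp only [crossCorr, add_sub_add_right_eq_sub]

lemma crossCorr_self_zero (u : (ι → Fin 2) → ZMod q) :
    crossCorr u u 0 = Fintype.card (ι → Fin 2) := by
  have key : ∀ y x : ι → Fin 2,
      (∀ i, ((y i : ℕ) : ℤ) - ((x i : ℕ) : ℤ) = (0 : ι → ℤ) i) ↔ y = x := by
    intro y x
    rw [funext_iff]
    refine forall_congr' fun i => ?_
    rw [Pi.zero_apply, sub_eq_zero, Nat.cast_inj, Fin.val_inj]
  simp only [crossCorr, key, Finset.sum_ite_eq, Finset.mem_univ, if_true, sub_self, zetaPow_zero]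
  simp

lemma crossCorr_split [NeZero q] (U : ι → Prop) [DecidablePred U]
    (p : ({i // U i} → Fin 2) → ZMod q) (r : ({i // ¬ U i} → Fin 2) → ZMod q) (τ : ι → ℤ) :
    crossCorr (fun x : ι → Fin 2 => p (fun i => x i) + r (fun i => x i))
        (fun x => p (fun i => x i) + r (fun i => x i)) τ =
      crossCorr p p (fun i => τ i) * crossCorr r r (fun i => τ i) := by
  rw [crossCorr, crossCorr, crossCorr, Finset.sum_mul_sum]
  refine Eq.trans ?_ (Fintype.sum_prod_type' _)
  refine Fintype.sum_equiv (Equiv.piEquivPiSubtypeProd U fun _ => Fin 2) _ _ fun y => ?_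
  rw [Finset.sum_mul_sum]
  refine Eq.trans ?_ (Fintype.sum_prod_type' _)
  refine Fintype.sum_equiv (Equiv.piEquivPiSubtypeProd U fun _ => Fin 2) _ _ fun x => ?_
  rw [ite_zero_mul_ite_zero]
  refine if_congr ?_ ?_ rfl
  · exact ⟨fun h => ⟨fun i => h i, fun i => h i⟩,
      fun h i => if hi : U i then h.1 ⟨i, hi⟩ else h.2 ⟨i, hi⟩⟩
  · rw [← zetaPow_add, add_sub_add_comm]
    rfl

lemma coeff_cubePoly_mul_conjRev [NeZero q] (u v : (ι → Fin 2) → ZMod q) (μ : ι →₀ ℕ) :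
    MvPolynomial.coeff μ (cubePoly (fun x => zetaPow q (u x)) *
      cubePoly (fun x => zetaPow q (conjRev v x))) = crossCorr u v (fun i => (μ i : ℤ) - 1) := by
  simp only [cubePoly, Finset.sum_mul_sum, MvPolynomial.coeff_sum, MvPolynomial.monomial_mul,
    MvPolynomial.coeff_monomial]
  refine Finset.sum_congr rfl fun y _ => Fintype.sum_equiv cubeRev _ _ fun x => ?_
  rw [← zetaPow_add, conjRev, ← sub_eq_add_neg]
  refine if_congr (Finsupp.ext_iff.trans (forall_congr' fun i => ?_)) rfl rfl
  rw [Finsupp.add_apply, exponent_apply, exponent_apply, cubeRev_apply, val_rev_fin_two]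
  change _ ↔ _ = (μ i : ℤ) - 1
  omega

lemma crossCorr_cons_zero {m : ℕ} (f : (Fin (m + 1) → Fin 2) → ZMod q) (τ : Fin m → ℤ) :
    crossCorr f f (Fin.cons 0 τ) =
      crossCorr (fun x => f (Fin.cons 0 x)) (fun x => f (Fin.cons 0 x)) τ +
        crossCorr (fun x => f (Fin.cons 1 x)) (fun x => f (Fin.cons 1 x)) τ := by
  simp only [crossCorr, ← (Fin.consEquiv fun _ => Fin 2).sum_comp, Fintype.sum_prod_type,
    Fin.sum_univ_two, Fin.forall_fin_succ]
  simp [Fin.consEquiv]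

lemma crossCorr_cons_one {m : ℕ} (f : (Fin (m + 1) → Fin 2) → ZMod q) (τ : Fin m → ℤ) :
    crossCorr f f (Fin.cons 1 τ) =
      crossCorr (fun x => f (Fin.cons 1 x)) (fun x => f (Fin.cons 0 x)) τ := by
  simp only [crossCorr, ← (Fin.consEquiv fun _ => Fin 2).sum_comp, Fintype.sum_prod_type,
    Fin.sum_univ_two, Fin.forall_fin_succ]
  simp [Fin.consEquiv]

/-- `IsGAP` for arrays indexed by a cube of arbitrary finite dimension. -/
def IsGolayPair (f g : (ι → Fin 2) → ZMod q) : Prop :=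
  ∀ τ : ι → ℤ, τ ≠ 0 → crossCorr f f τ + crossCorr g g τ = 0

lemma IsGolayPair.isGAP {m : ℕ} {f g : (Fin m → Fin 2) → ZMod q} (h : IsGolayPair f g) :
    IsGAP q m f g := fun τ _ hτ => by
  rw [corr_eq_crossCorr, corr_eq_crossCorr, h τ hτ]

lemma isGolayPair_of_isGAP {m : ℕ} {f g : (Fin m → Fin 2) → ZMod q} (h : IsGAP q m f g) :
    IsGolayPair f g := fun τ hτ => by
  by_cases hb : ∀ i, τ i = -1 ∨ τ i = 0 ∨ τ i = 1
  · rw [← corr_eq_crossCorr, ← corr_eq_crossCorr, h τ hb hτ]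
  · have hne : ∀ y x : Fin m → Fin 2, ¬ ∀ i, ((y i : ℕ) : ℤ) - ((x i : ℕ) : ℤ) = τ i :=
      fun y x hyx => hb fun i => by
        have := hyx i
        omega
    simp [crossCorr, hne]

lemma IsGolayPair.reindex {f g : (ι → Fin 2) → ZMod q} (h : IsGolayPair f g) (e : κ ≃ ι) :
    IsGolayPair (fun x : κ → Fin 2 => f (x ∘ e.symm)) (fun x => g (x ∘ e.symm)) := fun τ hτ => by
  rw [crossCorr_reindex, crossCorr_reindex]
  refine h _ fun h0 => hτ (funext fun i => ?_)
  simpa using congrFun h0 (e i)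

end Correlation

section PathSum

variable {R : Type*} [CommRing R]

/-- The sum of the products of consecutive entries of a list. -/
def pathSum : List R → R
  | [] => 0
  | [_] => 0
  | a :: b :: l => a * b + pathSum (b :: l)

lemma pathSum_cons (a : R) (l : List R) : pathSum (a :: l) = a * l.headD 0 + pathSum l := by
  cases l <;> simp [pathSum]

lemma pathSum_append_cons (l₁ : List R) (w : R) (l₂ : List R) :
    pathSum (l₁ ++ w :: l₂) =
      pathSum l₁ + l₁.getLastD 0 * w + w * l₂.headD 0 + pathSum l₂ := by
  induction l₁ with
  | nil => simp [pathSum_cons, pathSum]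
  | cons a l₁ ih =>
    rw [List.cons_append, pathSum_cons, ih, pathSum_cons a l₁]
    cases l₁ with
    | nil => simp; ring
    | cons b l₁ => simp; ring

lemma pathSum_reverse (l : List R) : pathSum l.reverse = pathSum l := by
  induction l with
  | nil => rfl
  | cons a l ih =>
    rw [List.reverse_cons, pathSum_append_cons, ih, pathSum_cons]
    simp [pathSum]
    ring

lemma pathSum_map_one_sub {h : R} (hh : h + h = 0) (l : List R) :
    h * pathSum (l.map (1 - ·)) =
      h * (pathSum l + l.headD 0 + l.getLastD 0) + h * (l.length - 1 : ℕ) := by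
  induction l with
  | nil => simp [pathSum]
  | cons a l ih =>
    rw [List.map_cons, pathSum_cons, mul_add, ih, pathSum_cons]
    cases l with
    | nil =>
      simp [pathSum]
      linear_combination (-a) * hh
    | cons b l =>
      simp
      linear_combination (-a) * hh

lemma pathSum_ofFn {n : ℕ} (F : Fin n → R) :
    pathSum (List.ofFn F) =
      ∑ k : Fin n, if h : (k : ℕ) + 1 < n then F k * F ⟨(k : ℕ) + 1, h⟩ else 0 := by
  induction n with
  | zero => simp [pathSum]
  | succ n ih =>
    rw [List.ofFn_succ, pathSum_cons, ih, Fin.sum_univ_succ]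
    congr 1
    · cases n <;> simp
    · simp [Fin.succ]

end PathSum

section Affine

variable {ι κ R : Type*} [Fintype ι] [Fintype κ] [CommRing R]

/-- The coordinates of a point of the cube, in a ring. -/
def bit (R : Type*) [CommRing R] {ι : Type*} (x : ι → Fin 2) (i : ι) : R := ((x i : ℕ) : R)

omit [Fintype ι] in
lemma bit_cubeRev (x : ι → Fin 2) (i : ι) : bit R (cubeRev x) i = 1 - bit R x i := by
  have : ((x i).rev : ℕ) + (x i : ℕ) = 1 := by
    rw [Fin.val_rev]
    omega
  rw [bit, bit, cubeRev_apply, eq_sub_iff_add_eq, ← Nat.cast_add, this, Nat.cast_one]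

/-- Affine functions on the cube. -/
def IsAffine (φ : (ι → Fin 2) → R) : Prop :=
  ∃ (c : ι → R) (c₀ : R), ∀ x, φ x = ∑ k, c k * bit R x k + c₀

lemma isAffine_const (a : R) : IsAffine fun _ : ι → Fin 2 => a := ⟨0, a, by simp⟩

lemma isAffine_bit (i : ι) : IsAffine fun x => bit R x i := by
  classical
  exact ⟨Pi.single i 1, 0, by simp [Pi.single_apply]⟩

lemma IsAffine.add {φ ψ : (ι → Fin 2) → R} (hφ : IsAffine φ) (hψ : IsAffine ψ) :
    IsAffine fun x => φ x + ψ x := by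
  obtain ⟨c, c₀, h⟩ := hφ
  obtain ⟨d, d₀, h'⟩ := hψ
  refine ⟨c + d, c₀ + d₀, fun x => ?_⟩
  simp only [h, h', Pi.add_apply, add_mul, Finset.sum_add_distrib]
  ring

lemma IsAffine.const_mul {φ : (ι → Fin 2) → R} (hφ : IsAffine φ) (a : R) :
    IsAffine fun x => a * φ x := by
  obtain ⟨c, c₀, h⟩ := hφ
  refine ⟨fun k => a * c k, a * c₀, fun x => ?_⟩
  simp only [h, mul_add, Finset.mul_sum, mul_assoc]

lemma isAffine_sum {α : Type*} (s : Finset α) {φ : α → (ι → Fin 2) → R}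
    (h : ∀ i ∈ s, IsAffine (φ i)) : IsAffine fun x => ∑ i ∈ s, φ i x := by
  classical
  induction s using Finset.induction_on with
  | empty => simpa using isAffine_const (0 : R)
  | insert a s ha ih =>
    simp only [Finset.sum_insert ha]
    exact (h a (Finset.mem_insert_self a s)).add
      (ih fun i hi => h i (Finset.mem_insert_of_mem hi))

lemma IsAffine.comp {φ : (κ → Fin 2) → R} (hφ : IsAffine φ) (e : κ → ι) :
    IsAffine fun x : ι → Fin 2 => φ fun i => x (e i) := by
  obtain ⟨c, c₀, h⟩ := hφ
  simp only [h]
  exact (isAffine_sum _ fun k _ => (isAffine_bit (e k)).const_mul (c k)).add (isAffine_const c₀)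

lemma IsAffine.exists_cubeRev {φ : (ι → Fin 2) → R} (hφ : IsAffine φ) :
    ∃ K, ∀ x, φ (cubeRev x) = -φ x + K := by
  obtain ⟨c, c₀, h⟩ := hφ
  refine ⟨∑ k, c k + 2 * c₀, fun x => ?_⟩
  simp only [h, bit_cubeRev, mul_sub, mul_one, Finset.sum_sub_distrib]
  ring

end Affine

section Standard

variable {ι κ R : Type*} [Fintype ι] [Fintype κ] [CommRing R]

lemma isAffine_getLastD (l : List ι) : IsAffine fun x => (l.map (bit R x)).getLastD 0 := by
  rcases List.eq_nil_or_concat l with rfl | ⟨l, i, rfl⟩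
  · exact isAffine_const 0
  · simpa using isAffine_bit i

omit [Fintype ι] in
lemma map_bit_cubeRev (l : List ι) (x : ι → Fin 2) :
    l.map (bit R (cubeRev x)) = (l.map (bit R x)).map (1 - ·) := by
  simp [Function.comp_def, bit_cubeRev]

/-- `IsStandard` for arrays indexed by a cube of arbitrary finite dimension and valued in a
commutative ring: the array is `h` times the path form of an enumeration `l` of the coordinates,
up to an affine function. -/
def IsStandardPair (h : R) (f g : (ι → Fin 2) → R) (l : List ι) : Prop :=
  l.Nodup ∧ (∀ i, i ∈ l) ∧
    (∃ φ, IsAffine φ ∧ ∀ x, f x = h * pathSum (l.map (bit R x)) + φ x) ∧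
    ∃ c', ∀ x, g x = f x + h * (l.map (bit R x)).headD 0 + c'

lemma IsStandardPair.exists_cubeRev {h : R} (hh : h + h = 0) {f g : (ι → Fin 2) → R}
    {l : List ι} (H : IsStandardPair h f g l) :
    ∃ K ε c' : R, (if l = [] then ε = 0 else ε = h) ∧ ∀ x,
      f (cubeRev x) =
        K - f x - h * (l.map (bit R x)).headD 0 - h * (l.map (bit R x)).getLastD 0 ∧
      g (cubeRev x) = K + ε + c' - f x - h * (l.map (bit R x)).getLastD 0 ∧
      g x = f x + h * (l.map (bit R x)).headD 0 + c' := by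
  obtain ⟨-, -, ⟨φ, hφ, hf⟩, c', hg⟩ := H
  obtain ⟨K, hK⟩ := hφ.exists_cubeRev
  have key : ∀ x, f (cubeRev x) = (h * (l.length - 1 : ℕ) + K) - f x -
      h * (l.map (bit R x)).headD 0 - h * (l.map (bit R x)).getLastD 0 := by
    intro x
    rw [hf, hf, map_bit_cubeRev, pathSum_map_one_sub hh, hK, List.length_map]
    linear_combination (pathSum (l.map (bit R x)) + (l.map (bit R x)).headD 0 +
      (l.map (bit R x)).getLastD 0) * hh
  refine ⟨_, if l = [] then 0 else h, c', ?_, fun x => ⟨key x, ?_, hg x⟩⟩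
  · split_ifs <;> rfl
  · rw [hg, key, map_bit_cubeRev]
    cases l with
    | nil => simp; ring
    | cons i l =>
      simp
      linear_combination (-bit R x i) * hh

lemma IsStandardPair.reindex (e : κ ≃ ι) {h : R} {f g : (ι → Fin 2) → R} {l : List κ}
    (H : IsStandardPair h (fun x : κ → Fin 2 => f (x ∘ e.symm)) (fun x => g (x ∘ e.symm)) l) :
    IsStandardPair h f g (l.map e) := by
  obtain ⟨hl, hmem, ⟨φ, hφ, hf⟩, c', hg⟩ := H
  have hmap : ∀ x : ι → Fin 2, (l.map e).map (bit R x) = l.map (bit R (x ∘ e)) := fun x => by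
    rw [List.map_map]
    rfl
  have hcomp : ∀ x : ι → Fin 2, (x ∘ e) ∘ e.symm = x := fun x => by
    rw [Function.comp_assoc, e.self_comp_symm, Function.comp_id]
  refine ⟨hl.map e.injective, fun i => List.mem_map.2 ⟨e.symm i, hmem _, e.apply_symm_apply i⟩,
    ⟨_, hφ.comp e, fun x => ?_⟩, c', fun x => ?_⟩
  · have := hf (x ∘ e)
    simp only [hcomp] at this
    rw [this, hmap]
    rfl
  · have := hg (x ∘ e)
    simp only [hcomp] at this
    rw [this, hmap]

/-- Two standard pairs on complementary sets of coordinates combine, through one further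
coordinate, into a standard pair. -/
lemma IsStandardPair.concat {m : ℕ} {U : Fin m → Prop} [DecidablePred U] {h : R} (hh : h + h = 0)
    {f g : (Fin (m + 1) → Fin 2) → R} {p s : ({i // U i} → Fin 2) → R} {lU : List {i // U i}}
    {t r : ({i // ¬ U i} → Fin 2) → R} {lV : List {i // ¬ U i}}
    (HU : IsStandardPair h p s lU) (HV : IsStandardPair h t r lV)
    (hf₀ : ∀ x : Fin m → Fin 2, f (Fin.cons 0 x) =
      -(s (cubeRev fun i => x i) + r (cubeRev fun i => x i)))
    (hf₁ : ∀ x : Fin m → Fin 2, f (Fin.cons 1 x) = p (fun i => x i) + t (fun i => x i))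
    (hg₀ : ∀ x : Fin m → Fin 2, g (Fin.cons 0 x) =
      h - (s (cubeRev fun i => x i) + t (cubeRev fun i => x i)))
    (hg₁ : ∀ x : Fin m → Fin 2, g (Fin.cons 1 x) = p (fun i => x i) + r (fun i => x i)) :
    ∃ l, IsStandardPair h f g l := by
  obtain ⟨KU, εU, cU, -, hU⟩ := HU.exists_cubeRev hh
  obtain ⟨KV, εV, cV, hεV, hV⟩ := HV.exists_cubeRev hh
  obtain ⟨hlU, hmU, ⟨φU, hφU, hp⟩, -⟩ := HU
  obtain ⟨hlV, hmV, ⟨φV, hφV, ht⟩, -⟩ := HV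
  let eU : {i // U i} → Fin (m + 1) := fun i => (i : Fin m).succ
  let eV : {i // ¬ U i} → Fin (m + 1) := fun i => (i : Fin m).succ
  have eU_inj : Function.Injective eU := (Fin.succ_injective m).comp Subtype.val_injective
  have eV_inj : Function.Injective eV := (Fin.succ_injective m).comp Subtype.val_injective
  let l : List (Fin (m + 1)) := lV.map eV ++ 0 :: (lU.map eU).reverse
  have hmap : ∀ x : Fin (m + 1) → Fin 2, l.map (bit R x) =
      lV.map (bit R (x ∘ eV)) ++ bit R x 0 :: (lU.map (bit R (x ∘ eU))).reverse := fun x => by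
    simp only [l, List.map_append, List.map_cons, List.map_reverse, List.map_map]
    rfl
  let K := KU + εU + cU + KV + εV + cV
  let φ : (Fin (m + 1) → Fin 2) → R := fun x => φU (x ∘ eU) + φV (x ∘ eV) +
    h * (lU.map (bit R (x ∘ eU))).getLastD 0 + h * (lV.map (bit R (x ∘ eV))).getLastD 0 +
    -K + K * bit R x 0
  have hφ : IsAffine φ := (((((hφU.comp eU).add (hφV.comp eV)).add
    (((isAffine_getLastD lU).comp eU).const_mul h)).add
    (((isAffine_getLastD lV).comp eV).const_mul h)).add (isAffine_const _)).add
    ((isAffine_bit 0).const_mul K)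
  have cases_cons : ∀ {motive : (Fin (m + 1) → Fin 2) → Prop},
      (∀ x, motive (Fin.cons 0 x)) → (∀ x, motive (Fin.cons 1 x)) → ∀ x, motive x := by
    intro motive h₀ h₁ x
    rw [← Fin.cons_self_tail x]
    generalize x 0 = a
    fin_cases a
    exacts [h₀ _, h₁ _]
  have bit_zero : ∀ x : Fin m → Fin 2, bit R (Fin.cons 0 x : Fin (m + 1) → Fin 2) 0 = 0 := by
    simp [bit]
  have bit_one : ∀ x : Fin m → Fin 2, bit R (Fin.cons 1 x : Fin (m + 1) → Fin 2) 0 = 1 := by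
    simp [bit]
  have comp_eU : ∀ (a : Fin 2) (x : Fin m → Fin 2),
      (Fin.cons a x : Fin (m + 1) → Fin 2) ∘ eU = fun i : {i // U i} => x i := fun a x => rfl
  have comp_eV : ∀ (a : Fin 2) (x : Fin m → Fin 2),
      (Fin.cons a x : Fin (m + 1) → Fin 2) ∘ eV = fun i : {i // ¬ U i} => x i := fun a x => rfl
  refine ⟨l, ?_, ?_, ⟨φ, hφ, cases_cons (fun x => ?_) fun x => ?_⟩, ?_⟩
  · rw [List.nodup_append, List.nodup_cons, List.nodup_reverse]
    refine ⟨hlV.map eV_inj, ⟨?_, hlU.map eU_inj⟩, ?_⟩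
    · simp [eU, Fin.succ_ne_zero]
    · simp only [List.mem_map, List.mem_cons, List.mem_reverse, eU, eV]
      rintro _ ⟨⟨i, hi⟩, -, rfl⟩ _ (rfl | ⟨⟨j, hj⟩, -, rfl⟩)
      · exact Fin.succ_ne_zero i
      · rintro hij
        obtain rfl : i = j := Fin.succ_injective m hij
        exact hi hj
  · refine Fin.cases (by simp [l]) fun i => ?_
    by_cases hi : U i
    · exact List.mem_append_right _ (List.mem_cons_of_mem _ (List.mem_reverse.2
        (List.mem_map.2 ⟨⟨i, hi⟩, hmU _, rfl⟩)))
    · exact List.mem_append_left _ (List.mem_map.2 ⟨⟨i, hi⟩, hmV _, rfl⟩)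
  · rw [hmap, pathSum_append_cons, pathSum_reverse, hf₀, (hU _).2.1, (hV _).2.1, hp, ht]
    simp only [φ, K, bit_zero, comp_eU, comp_eV]
    ring
  · rw [hmap, pathSum_append_cons, pathSum_reverse, hf₁, hp, ht]
    simp only [φ, K, bit_one, comp_eU, comp_eV, List.headD_eq_head?_getD, List.head?_reverse,
      List.getLastD_eq_getLast?]
    linear_combination (-((lU.map (bit R fun i : {i // U i} => x i)).getLast?.getD 0 +
      (lV.map (bit R fun i : {i // ¬ U i} => x i)).getLast?.getD 0)) * hh
  · by_cases hl : lV = []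
    · subst hl
      rw [if_pos rfl] at hεV
      refine ⟨cV + h, cases_cons (fun x => ?_) fun x => ?_⟩
      · rw [hmap, hf₀, hg₀, (hU _).2.1, (hV _).2.1, (hV _).1, hεV]
        simp only [bit_zero, List.map_nil, List.nil_append, List.headD_cons, List.headD_nil]
        ring
      · rw [hmap, hf₁, hg₁, (hV _).2.2]
        simp only [bit_one, List.map_nil, List.nil_append, List.headD_cons, List.headD_nil]
        linear_combination -hh
    · rw [if_neg hl] at hεV
      obtain ⟨v, lV, rfl⟩ := List.exists_cons_of_ne_nil hl
      refine ⟨cV, cases_cons (fun x => ?_) fun x => ?_⟩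
      · rw [hmap, hf₀, hg₀, (hU _).2.1, (hV _).2.1, (hV _).1, hεV]
        simp only [comp_eV, List.map_cons, List.cons_append, List.headD_cons]
        linear_combination hh
      · rw [hmap, hf₁, hg₁, (hV _).2.2]
        simp only [comp_eV, List.map_cons, List.cons_append, List.headD_cons]
        ring

end Standard

section Conversion

lemma exists_ofFn_perm {n : ℕ} {l : List (Fin n)} (hl : l.Nodup) (hmem : ∀ i, i ∈ l) :
    ∃ π : Equiv.Perm (Fin n), l = List.ofFn π := by
  have hlen : l.length = n := by
    rw [← List.toFinset_card_of_nodup hl,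
      Finset.eq_univ_iff_forall.2 fun i => List.mem_toFinset.2 (hmem i), Finset.card_fin]
  obtain ⟨F, rfl⟩ : ∃ F : Fin n → Fin n, l = List.ofFn F :=
    ⟨fun i => l.get (i.cast hlen.symm), List.ext_get (by simp [hlen]) (by simp)⟩
  exact ⟨Equiv.ofBijective F (Finite.injective_iff_bijective.1 (List.nodup_ofFn.1 hl)), rfl⟩

variable {q n : ℕ} {f g : (Fin n → Fin 2) → ZMod q}

lemma IsStandardPair.isStandard (hn : 0 < n) {l : List (Fin n)}
    (H : IsStandardPair ((q / 2 : ℕ) : ZMod q) f g l) : IsStandard q n hn f g := by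
  obtain ⟨hl, hmem, ⟨φ, ⟨c, c₀, hφ⟩, hf⟩, c', hg⟩ := H
  obtain ⟨π, rfl⟩ := exists_ofFn_perm hl hmem
  obtain ⟨n, rfl⟩ := Nat.exists_eq_succ_of_ne_zero hn.ne'
  refine ⟨π, c₀, c', c, fun x => ?_, fun x => ?_⟩
  · rw [hf, hφ, List.map_ofFn, pathSum_ofFn, ← add_assoc]
    rfl
  · rw [hg, List.map_ofFn]
    simp [bit]

lemma exists_isStandardPair_of_isStandard {hn : 0 < n} (H : IsStandard q n hn f g) :
    ∃ l, IsStandardPair ((q / 2 : ℕ) : ZMod q) f g l := by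
  obtain ⟨π, c₀, c', c, hf, hg⟩ := H
  obtain ⟨n, rfl⟩ := Nat.exists_eq_succ_of_ne_zero hn.ne'
  refine ⟨List.ofFn π, List.nodup_ofFn.2 π.injective, fun i => ?_,
    ⟨_, ⟨c, c₀, fun x => rfl⟩, fun x => ?_⟩, c', fun x => ?_⟩
  · exact (List.mem_ofFn' _ _).2 (π.surjective i)
  · rw [hf, List.map_ofFn, pathSum_ofFn, ← add_assoc]
    rfl
  · rw [hg, List.map_ofFn]
    simp [bit]

end Conversion

section Induction

variable {ι : Type*} [Fintype ι] [DecidableEq ι] {q : ℕ}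

lemma exists_isStandardPair {m : ℕ}
    (ih : ∀ n, ∀ hn : 0 < n, n ≤ m →
      ∀ f g : (Fin n → Fin 2) → ZMod q, IsGAP q n f g → IsStandard q n hn f g)
    (hι : Fintype.card ι ≤ m) {f g : (ι → Fin 2) → ZMod q} (H : IsGolayPair f g) :
    ∃ l, IsStandardPair ((q / 2 : ℕ) : ZMod q) f g l := by
  rcases (Fintype.card ι).eq_zero_or_pos with h0 | hpos
  · have := Fintype.card_eq_zero_iff.1 h0
    refine ⟨[], List.nodup_nil, isEmptyElim, ⟨_, isAffine_const (f default), fun x => ?_⟩,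
      g default - f default, fun x => ?_⟩ <;>
    simp [pathSum, Subsingleton.elim x default]
  · let e := (Fintype.equivFin ι).symm
    obtain ⟨l, hl⟩ :=
      exists_isStandardPair_of_isStandard (ih _ hpos hι _ _ (H.reindex e).isGAP)
    exact ⟨_, hl.reindex e⟩

variable [NeZero q]

lemma exists_split {b a d c : (ι → Fin 2) → ZMod q}
    (h : cubePoly (fun x => zetaPow q (b x)) * cubePoly (fun x => zetaPow q (a x)) =
      cubePoly (fun x => zetaPow q (d x)) * cubePoly (fun x => zetaPow q (c x))) :
    ∃ (U : ι → Prop) (p s : ({i // U i} → Fin 2) → ZMod q)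
      (t r : ({i // ¬ U i} → Fin 2) → ZMod q),
      (∀ x, b x = p (fun i => x i) + t (fun i => x i)) ∧
      (∀ x, d x = p (fun i => x i) + r (fun i => x i)) ∧
      (∀ x, c x = s (fun i => x i) + t (fun i => x i)) ∧
      ∀ x, a x = s (fun i => x i) + r (fun i => x i) := by
  classical
  obtain ⟨U, P, S, Q, R, H⟩ := exists_split_of_cubePoly_mul_eq (fun _ => zetaPow_ne_zero _)
    (fun _ => zetaPow_ne_zero _) (fun _ => zetaPow_ne_zero _) (fun _ => zetaPow_ne_zero _) h
  have hPQ : P 0 * Q 0 ≠ 0 := (H 0).1 ▸ zetaPow_ne_zero (b 0)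
  have hP := left_ne_zero_of_mul hPQ
  have hQ := right_ne_zero_of_mul hPQ
  let glue : ({i // U i} → Fin 2) → ({i // ¬ U i} → Fin 2) → ι → Fin 2 := fun u v =>
    (Equiv.piEquivPiSubtypeProd U fun _ => Fin 2).symm (u, v)
  have glue_left : ∀ u v, (fun i : {i // U i} => glue u v i) = u := fun u v =>
    congrArg Prod.fst ((Equiv.piEquivPiSubtypeProd U fun _ => Fin 2).apply_symm_apply (u, v))
  have glue_right : ∀ u v, (fun i : {i // ¬ U i} => glue u v i) = v := fun u v =>
    congrArg Prod.snd ((Equiv.piEquivPiSubtypeProd U fun _ => Fin 2).apply_symm_apply (u, v))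
  have Hb := fun x => (H x).1
  have Hd := fun x => (H x).2.1
  have Hc := fun x => (H x).2.2.1
  have Ha := fun x => (H x).2.2.2
  refine ⟨U, fun u => b (glue u 0), fun u => c (glue u 0),
    fun v => b (glue 0 v) - b (glue 0 0), fun v => d (glue 0 v) - b (glue 0 0), ?_, ?_, ?_, ?_⟩ <;>
  · intro x
    apply zetaPow_injective
    simp only [zetaPow_add, zetaPow_sub, Hb, Hd, Hc, Ha, glue_left, glue_right]
    field_simp

lemma crossCorr_sub_half (hq : Even q) (u v : (ι → Fin 2) → ZMod q) (τ : ι → ℤ) :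
    crossCorr u (fun x => v x - ((q / 2 : ℕ) : ZMod q)) τ = -crossCorr u v τ := by
  simp only [crossCorr, ← sub_add, zetaPow_add, zetaPow_half hq, mul_neg_one,
    ← Finset.sum_neg_distrib, neg_ite, neg_zero]

omit [NeZero q] in
lemma isGolayPair_of_mul_eq_zero (U : ι → Prop) [DecidablePred U]
    {p s : ({i // U i} → Fin 2) → ZMod q} {t r : ({i // ¬ U i} → Fin 2) → ZMod q}
    (h : ∀ τ : ι → ℤ, τ ≠ 0 →
      (crossCorr p p (fun i => τ i) + crossCorr s s fun i => τ i) *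
        (crossCorr t t (fun i => τ i) + crossCorr r r fun i => τ i) = 0) :
    IsGolayPair p s ∧ IsGolayPair t r := by
  have corr_ne_zero : ∀ {κ : Type _} [Fintype κ] [DecidableEq κ] (u v : (κ → Fin 2) → ZMod q),
      crossCorr u u 0 + crossCorr v v 0 ≠ 0 := by
    intro κ _ _ u v
    rw [crossCorr_self_zero, crossCorr_self_zero]
    exact_mod_cast (add_pos Fintype.card_pos Fintype.card_pos).ne'
  let e := Equiv.piEquivPiSubtypeProd U fun _ => ℤ
  have key : ∀ τU τV, (τU, τV) ≠ 0 →
      (crossCorr p p τU + crossCorr s s τU) * (crossCorr t t τV + crossCorr r r τV) = 0 := by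
    intro τU τV hτ
    have he : e (e.symm (τU, τV)) = (τU, τV) := e.apply_symm_apply _
    have := h (e.symm (τU, τV)) fun h0 => hτ (by rw [← he, h0]; rfl)
    change (crossCorr p p (e _).1 + crossCorr s s (e _).1) *
      (crossCorr t t (e _).2 + crossCorr r r (e _).2) = 0 at this
    rwa [he] at this
  exact ⟨fun τ hτ => (mul_eq_zero.1 (key τ 0 fun h0 => hτ (congrArg Prod.fst h0))).resolve_right
      (corr_ne_zero t r),
    fun τ hτ => (mul_eq_zero.1 (key 0 τ fun h0 => hτ (congrArg Prod.snd h0))).resolve_left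
      (corr_ne_zero p s)⟩

/-- The four quarters of a Golay array pair split over complementary sets of coordinates into two
Golay array pairs. -/
lemma exists_isGolayPair_split {a b c d : (ι → Fin 2) → ZMod q}
    (hcross : ∀ τ, crossCorr b a τ = crossCorr d c τ)
    (hauto : ∀ τ, τ ≠ 0 →
      crossCorr a a τ + crossCorr b b τ + (crossCorr c c τ + crossCorr d d τ) = 0) :
    ∃ (U : ι → Prop) (p s : ({i // U i} → Fin 2) → ZMod q)
      (t r : ({i // ¬ U i} → Fin 2) → ZMod q) (_ : DecidablePred U),
      IsGolayPair p s ∧ IsGolayPair t r ∧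
      (∀ x, a x = -(s (cubeRev fun i => x i) + r (cubeRev fun i => x i))) ∧
      (∀ x, b x = p (fun i => x i) + t (fun i => x i)) ∧
      (∀ x, c x = -(s (cubeRev fun i => x i) + t (cubeRev fun i => x i))) ∧
      ∀ x, d x = p (fun i => x i) + r (fun i => x i) := by
  classical
  obtain ⟨U, p, s, t, r, hb, hd, hc, ha⟩ : ∃ (U : ι → Prop) (p s : ({i // U i} → Fin 2) → ZMod q)
      (t r : ({i // ¬ U i} → Fin 2) → ZMod q),
      (∀ x, b x = p (fun i => x i) + t (fun i => x i)) ∧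
      (∀ x, d x = p (fun i => x i) + r (fun i => x i)) ∧
      (∀ x, conjRev c x = s (fun i => x i) + t (fun i => x i)) ∧
      ∀ x, conjRev a x = s (fun i => x i) + r (fun i => x i) := by
    refine exists_split (MvPolynomial.ext _ _ fun μ => ?_)
    rw [coeff_cubePoly_mul_conjRev, coeff_cubePoly_mul_conjRev, hcross]
  have unrev : ∀ {u e : (ι → Fin 2) → ZMod q}, (∀ x, conjRev u x = e x) →
      ∀ x, u x = -e (cubeRev x) := fun h x => by
    rw [← h, conjRev, cubeRev_cubeRev, neg_neg]
  obtain ⟨GU, GV⟩ : IsGolayPair p s ∧ IsGolayPair t r := by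
    refine isGolayPair_of_mul_eq_zero U fun τ hτ => ?_
    have h0 := hauto τ hτ
    rw [← crossCorr_conjRev a, ← crossCorr_conjRev c, funext ha, funext hb, funext hc, funext hd,
      crossCorr_split, crossCorr_split, crossCorr_split, crossCorr_split] at h0
    linear_combination h0
  exact ⟨U, p, s, t, r, inferInstance, GU, GV, unrev ha, hb, unrev hc, hd⟩

lemma isStandard_succ (hq : Even q) {m : ℕ}
    (ih : ∀ n, ∀ hn : 0 < n, n ≤ m →
      ∀ f g : (Fin n → Fin 2) → ZMod q, IsGAP q n f g → IsStandard q n hn f g)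
    {f g : (Fin (m + 1) → Fin 2) → ZMod q} (hfg : IsGolayPair f g) :
    IsStandard q (m + 1) (Nat.succ_pos m) f g := by
  have hcross : ∀ τ : Fin m → ℤ,
      crossCorr (fun x => f (Fin.cons 1 x)) (fun x => f (Fin.cons 0 x)) τ =
        crossCorr (fun x => g (Fin.cons 1 x))
          (fun x => g (Fin.cons 0 x) - ((q / 2 : ℕ) : ZMod q)) τ := by
    intro τ
    rw [crossCorr_sub_half hq, ← crossCorr_cons_one, ← crossCorr_cons_one, eq_neg_iff_add_eq_zero]
    exact hfg _ fun h0 => one_ne_zero (congrFun h0 0)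
  obtain ⟨U, p, s, t, r, _, GU, GV, ha, hb, hc, hd⟩ := exists_isGolayPair_split hcross (by
    intro τ hτ
    have h0 := hfg (Fin.cons 0 τ) fun h0 => hτ (funext fun i => congrFun h0 i.succ)
    rw [crossCorr_cons_zero, crossCorr_cons_zero] at h0
    simp only [sub_eq_add_neg, crossCorr_add_const]
    exact h0)
  have card_le : ∀ (V : Fin m → Prop) [DecidablePred V], Fintype.card {i // V i} ≤ m := fun V _ =>
    (Fintype.card_subtype_le V).trans_eq (Fintype.card_fin m)
  obtain ⟨lU, HU⟩ := exists_isStandardPair ih (card_le _) GU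
  obtain ⟨lV, HV⟩ := exists_isStandardPair ih (card_le _) GV
  obtain ⟨l, hl⟩ := HU.concat (half_add_half hq) HV ha hb
    (fun x => by rw [sub_eq_add_neg, ← hc, add_sub_cancel]) hd
  exact hl.isStandard _

end Induction

end GolayArray

/-- if every q-ary GAP of size 2^(n) is standard for all 1 ≤ n ≤ m, then
    every q-ary GAP of size 2^(m+1) is standard. -/
theorem gap_standard_induction_step (q m : ℕ) (hq : 0 < q) (hqe : Even q) (hm : 1 ≤ m)
    (ih : ∀ n, ∀ hn : 0 < n, n ≤ m →
      ∀ f g : (Fin n → Fin 2) → ZMod q, IsGAP q n f g → IsStandard q n hn f g) :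
    ∀ f g : (Fin (m + 1) → Fin 2) → ZMod q, IsGAP q (m + 1) f g →
      IsStandard q (m + 1) (Nat.succ_pos m) f g := by
  intro f g hfg
  have : NeZero q := ⟨hq.ne'⟩
  exact GolayArray.isStandard_succ hqe ih (GolayArray.isGolayPair_of_isGAP hfg)
end
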